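/- arXiv:1407.1018 — 2 statements merged into one kernel-verified Lean document; each statement's English description precedes it below -/
import Mathlib

section
/- Let q be an odd prime power with 3 not dividing q, and let j be a nonnegative integer. Then m_4(q;j) = q·m_3(q;j) if j is even, and m_4(q;j) = m_3(q;j+1) if j is odd. -/
open Polynomial Finset
open scoped Classical

/-- The quadratic character of a field: `χ(0)=0`, `χ(a)=1` if `a` is a nonzero square,
`χ(a)=-1` otherwise. -/
noncomputable def quadChar (F : Type*) [Field F] (a : F) : ℤ :=
  if a = 0 then 0 else if IsSquare a then 1 else -1

/-- `a_q(D) = -Σ_{x ∈ F_q} χ(D(x))`. -/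
noncomputable def aQ {F : Type*} [Field F] [Fintype F] (D : Polynomial F) : ℤ :=
  -∑ x : F, quadChar F (D.eval x)

/-- `m₃(q;j) = Σ_{D ∈ H_{q,3}} (−a_q(D))^j`, where monic (squarefree) cubics are
parametrized by their three non-leading coefficients. -/
noncomputable def m3 (F : Type*) [Field F] [Fintype F] (j : ℕ) : ℤ :=
  ∑ c : F × F × F,
    if Squarefree (X ^ 3 + C c.1 * X ^ 2 + C c.2.1 * X + C c.2.2 : Polynomial F) then
      (-aQ (X ^ 3 + C c.1 * X ^ 2 + C c.2.1 * X + C c.2.2 : Polynomial F)) ^ j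
    else 0

/-- `m₄(q;j) = Σ_{D ∈ H_{q,4}} (1 − a_q(D))^j`, where monic (squarefree) quartics are
parametrized by their four non-leading coefficients. -/
noncomputable def m4 (F : Type*) [Field F] [Fintype F] (j : ℕ) : ℤ :=
  ∑ c : F × F × F × F,
    if Squarefree
        (X ^ 4 + C c.1 * X ^ 3 + C c.2.1 * X ^ 2 + C c.2.2.1 * X + C c.2.2.2 :
          Polynomial F) then
      (1 - aQ (X ^ 4 + C c.1 * X ^ 3 + C c.2.1 * X ^ 2 + C c.2.2.1 * X + C c.2.2.2 :
          Polynomial F)) ^ j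
    else 0


namespace MomAux

def disc3 {R : Type*} [CommRing R] (A B C : R) : R :=
  A ^ 2 * B ^ 2 - 4 * B ^ 3 - 4 * A ^ 3 * C - 27 * C ^ 2 + 18 * A * B * C

lemma coeffs3 {K : Type*} [Field K] {a b c a' b' c' : K}
    (h : X ^ 3 + C a * X ^ 2 + C b * X + C c = X ^ 3 + C a' * X ^ 2 + C b' * X + C c') :
    a = a' ∧ b = b' ∧ c = c' := by
  have e0 := congrArg (fun p => p.coeff 0) h
  have e1 := congrArg (fun p => p.coeff 1) h
  have e2 := congrArg (fun p => p.coeff 2) h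
  simp [coeff_X, coeff_C, coeff_X_pow] at e0 e1 e2
  exact ⟨e2, e1, e0⟩

lemma coeffs4 {K : Type*} [Field K] {a b c d a' b' c' d' : K}
    (h : X ^ 4 + C a * X ^ 3 + C b * X ^ 2 + C c * X + C d =
      X ^ 4 + C a' * X ^ 3 + C b' * X ^ 2 + C c' * X + C d') :
    a = a' ∧ b = b' ∧ c = c' ∧ d = d' := by
  have e0 := congrArg (fun p => p.coeff 0) h
  have e1 := congrArg (fun p => p.coeff 1) h
  have e2 := congrArg (fun p => p.coeff 2) h
  have e3 := congrArg (fun p => p.coeff 3) h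
  simp [coeff_X, coeff_C, coeff_X_pow] at e0 e1 e2 e3
  exact ⟨e3, e2, e1, e0⟩

variable {F : Type*} [Field F] [Fintype F]

lemma sf3 (a b c : F) :
    Squarefree (X ^ 3 + C a * X ^ 2 + C b * X + C c : F[X]) ↔ disc3 a b c ≠ 0 := by
  set P : F[X] := X ^ 3 + C a * X ^ 2 + C b * X + C c with hP
  have hdeg : P.natDegree = 3 := by rw [hP]; compute_degree!
  have hmon : P.Monic := by rw [hP]; monicity!
  let K := AlgebraicClosure F
  have hs : (P.map (algebraMap F K)).Splits := IsAlgClosed.splits _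
  have hm := hmon.map (algebraMap F K)
  rw [← PerfectField.separable_iff_squarefree, ← nodup_aroots_iff_of_splits hmon.ne_zero hs]
  have hcard : (P.map (algebraMap F K)).roots.card = 3 := by
    rw [← hs.natDegree_eq_card_roots, natDegree_map, hdeg]
  have hprod := hs.eq_prod_roots_of_monic hm
  obtain ⟨x, y, z, hr⟩ := Multiset.card_eq_three.1 hcard
  change (P.map (algebraMap F K)).roots.Nodup ↔ _
  rw [hr] at hprod ⊢
  have hexp : X ^ 3 + C (algebraMap F K a) * X ^ 2 + C (algebraMap F K b) * X
      + C (algebraMap F K c) = X ^ 3 + C (-(x+y+z)) * X ^ 2 + C (x*y+x*z+y*z) * X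
        + C (-(x*y*z)) := by
    have h1 : X ^ 3 + C (algebraMap F K a) * X ^ 2 + C (algebraMap F K b) * X
      + C (algebraMap F K c) = P.map (algebraMap F K) := by simp [hP]
    rw [h1, hprod]
    simp
    ring
  obtain ⟨e2, e1, e0⟩ := coeffs3 hexp
  have hd : algebraMap F K (disc3 a b c) = ((x-y)*(x-z)*(y-z))^2 := by
    simp only [disc3, map_add, map_sub, map_mul, map_pow, map_ofNat, e0, e1, e2]
    ring
  rw [← map_ne_zero (algebraMap F K), hd]
  simp [sub_eq_zero, and_assoc]

/-- discriminant of the quartic, as the discriminant of its resolvent cubic -/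
def disc4 {R : Type*} [CommRing R] (p q r s : R) : R :=
  disc3 (-q) (p * r - 4 * s) (4 * q * s - r ^ 2 - p ^ 2 * s)

lemma sf4 (a b c d : F) :
    Squarefree (X ^ 4 + C a * X ^ 3 + C b * X ^ 2 + C c * X + C d : F[X]) ↔
      disc4 a b c d ≠ 0 := by
  set P : F[X] := X ^ 4 + C a * X ^ 3 + C b * X ^ 2 + C c * X + C d with hP
  have hdeg : P.natDegree = 4 := by rw [hP]; compute_degree!
  have hmon : P.Monic := by rw [hP]; monicity!
  let K := AlgebraicClosure F
  have hs : (P.map (algebraMap F K)).Splits := IsAlgClosed.splits _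
  have hm := hmon.map (algebraMap F K)
  rw [← PerfectField.separable_iff_squarefree, ← nodup_aroots_iff_of_splits hmon.ne_zero hs]
  have hcard : (P.map (algebraMap F K)).roots.card = 3 + 1 := by
    rw [← hs.natDegree_eq_card_roots, natDegree_map, hdeg]
  have hprod := hs.eq_prod_roots_of_monic hm
  obtain ⟨w, hw⟩ := Multiset.card_pos_iff_exists_mem.1
    (by omega : 0 < (P.map (algebraMap F K)).roots.card)
  obtain ⟨t, hr⟩ := Multiset.exists_cons_of_mem hw
  have ht : t.card = 3 := by
    rw [hr, Multiset.card_cons] at hcard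
    omega
  obtain ⟨x, y, z, rfl⟩ := Multiset.card_eq_three.1 ht
  change (P.map (algebraMap F K)).roots.Nodup ↔ _
  rw [hr] at hprod ⊢
  have hexp : X ^ 4 + C (algebraMap F K a) * X ^ 3 + C (algebraMap F K b) * X ^ 2
      + C (algebraMap F K c) * X
      + C (algebraMap F K d) = X ^ 4 + C (-(x+y+z+w)) * X ^ 3
        + C (x*y+x*z+y*z+w*x+w*y+w*z) * X ^ 2
        + C (-(x*y*z+w*x*y+w*x*z+w*y*z)) * X + C (w*x*y*z) := by
    have h1 : X ^ 4 + C (algebraMap F K a) * X ^ 3 + C (algebraMap F K b) * X ^ 2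
      + C (algebraMap F K c) * X
      + C (algebraMap F K d) = P.map (algebraMap F K) := by simp [hP]
    rw [h1, hprod]
    simp
    ring
  obtain ⟨e3, e2, e1, e0⟩ := coeffs4 hexp
  have hd : algebraMap F K (disc4 a b c d) =
      ((x-y)*(x-z)*(y-z)*(w-x)*(w-y)*(w-z))^2 := by
    simp only [disc4, disc3, map_add, map_sub, map_neg, map_mul, map_pow, map_ofNat,
      e0, e1, e2, e3]
    ring
  rw [← map_ne_zero (algebraMap F K), hd]
  simp [sub_eq_zero]
  tauto

noncomputable def S3 (a b c : F) : ℤ := ∑ x : F, quadChar F (x ^ 3 + a * x ^ 2 + b * x + c)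

noncomputable def W (j : ℕ) (a b c : F) : ℤ := if disc3 a b c ≠ 0 then S3 a b c ^ j else 0

noncomputable def S4 (a b c d : F) : ℤ :=
  ∑ x : F, quadChar F (x ^ 4 + a * x ^ 3 + b * x ^ 2 + c * x + d)

lemma m3_eq (j : ℕ) : m3 F j = ∑ c : F × F × F, W j c.1 c.2.1 c.2.2 := by
  unfold m3 W
  refine Finset.sum_congr rfl fun c _ => ?_
  simp only [sf3]
  simp [aQ, S3]

lemma m4_eq (j : ℕ) : m4 F j = ∑ c : F × F × F × F,
    if disc4 c.1 c.2.1 c.2.2.1 c.2.2.2 ≠ 0 then (1 + S4 c.1 c.2.1 c.2.2.1 c.2.2.2) ^ j else 0 := by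
  unfold m4
  refine Finset.sum_congr rfl fun c _ => ?_
  simp only [sf4]
  simp [aQ, S4]

lemma qc_eq (a : F) : quadChar F a = quadraticChar F a := by
  rw [quadraticChar_apply]
  unfold quadChar quadraticCharFun
  congr

lemma qc_mul (a b : F) : quadChar F (a * b) = quadChar F a * quadChar F b := by
  rw [qc_eq, qc_eq, qc_eq, map_mul]

lemma sqrts (h2 : ringChar F ≠ 2) (a : F) :
    ∑ y : F, (if y ^ 2 = a then (1 : ℤ) else 0) = 1 + quadChar F a := by
  rw [qc_eq, add_comm, ← quadraticChar_card_sqrts h2 a, Finset.sum_boole]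
  congr 2
  ext; simp

lemma quad_count (h2 : ringChar F ≠ 2) (α β γ : F) (hα : α ≠ 0) :
    ∑ x : F, (if α * x ^ 2 + β * x + γ = 0 then (1 : ℤ) else 0)
      = 1 + quadChar F (β ^ 2 - 4 * α * γ) := by
  have h2' : (2 : F) ≠ 0 := Ring.two_ne_zero h2
  rw [← sqrts h2]
  have hk : 2 * α ≠ 0 := mul_ne_zero h2' hα
  refine Fintype.sum_equiv ((Equiv.mulLeft₀ (2 * α) hk).trans (Equiv.addRight β)) _ _ ?_
  intro x
  change _ = if (2 * α * x + β) ^ 2 = β ^ 2 - 4 * α * γ then (1 : ℤ) else 0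
  congr 1
  have : (2 * α * x + β) ^ 2 - (β ^ 2 - 4 * α * γ) = (4 * α) * (α * x ^ 2 + β * x + γ) := by ring
  have h4 : 4 * α ≠ 0 := by
    have : 4 * α = 2 * (2 * α) := by ring
    rw [this]; exact mul_ne_zero h2' hk
  rw [← sub_eq_zero (a := (2 * α * x + β) ^ 2), this]
  simp [h4]

lemma key (h2 : ringChar F ≠ 2) (a b c : F) (hnd : ¬ (b = 0 ∧ a ^ 2 = 4 * c)) :
    1 + ∑ x : F, quadChar F (x ^ 4 + a * x ^ 2 + b * x + c) =
      S3 a (-4 * c) (b ^ 2 - 4 * a * c) := by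
  have h2' : (2 : F) ≠ 0 := Ring.two_ne_zero h2
  have hL : ∑ x : F, (1 + quadChar F (x ^ 4 + a * x ^ 2 + b * x + c)) =
      ∑ u : F, ∑ x : F,
        (if (2 * u + a) * x ^ 2 + b * x + (c - u ^ 2) = 0 then (1 : ℤ) else 0) := by
    rw [Finset.sum_comm]
    refine Finset.sum_congr rfl fun x _ => ?_
    rw [← sqrts h2]
    refine Fintype.sum_equiv (Equiv.addRight (x ^ 2)) _ _ ?_
    intro y
    simp only [Equiv.coe_addRight]
    congr 1
    apply propext
    constructor
    · intro h; linear_combination -h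
    · intro h; linear_combination -h
  have hR : ∀ u : F, ∑ x : F,
        (if (2 * u + a) * x ^ 2 + b * x + (c - u ^ 2) = 0 then (1 : ℤ) else 0) =
      1 + quadChar F ((2 * u) ^ 3 + a * (2 * u) ^ 2 + (-4 * c) * (2 * u) + (b ^ 2 - 4 * a * c))
        - (if u = -a / 2 then 1 else 0) := by
    intro u
    have harg : (2 * u) ^ 3 + a * (2 * u) ^ 2 + (-4 * c) * (2 * u) + (b ^ 2 - 4 * a * c) =
      b ^ 2 - 4 * (2 * u + a) * (c - u ^ 2) := by ring
    rw [harg]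
    by_cases hu : u = -a / 2
    · have h0 : 2 * u + a = 0 := by rw [hu]; field_simp; ring
      rw [h0, if_pos hu]
      by_cases hb : b = 0
      · have : c - u ^ 2 ≠ 0 := by
          intro h
          apply hnd
          refine ⟨hb, ?_⟩
          have : a = -(2 * u) := by linear_combination h0
          rw [this]
          linear_combination -4 * h
        simp [hb, this, quadChar]
      · have hsq : quadChar F (b ^ 2 - 4 * 0 * (c - u ^ 2)) = 1 := by
          simp [quadChar, hb, IsSquare.sq]
        rw [hsq]
        have : ∀ x : F, (0 * x ^ 2 + b * x + (c - u ^ 2) = 0) ↔ x = -(c - u ^ 2) / b := by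
          intro x
          rw [eq_div_iff hb]
          constructor
          · intro h; linear_combination h
          · intro h; linear_combination h
        simp only [this]
        simp
    · have h0 : 2 * u + a ≠ 0 := by
        intro h
        apply hu
        field_simp
        linear_combination h
      rw [quad_count h2 _ _ _ h0, if_neg hu]
      ring
  simp only [hR] at hL
  rw [Finset.sum_sub_distrib, Finset.sum_add_distrib, Finset.sum_add_distrib] at hL
  have hS : ∑ u : F, quadChar F ((2 * u) ^ 3 + a * (2 * u) ^ 2 + (-4 * c) * (2 * u)
      + (b ^ 2 - 4 * a * c)) = S3 a (-4 * c) (b ^ 2 - 4 * a * c) :=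
    Fintype.sum_equiv (Equiv.mulLeft₀ 2 h2') _ _ (fun u => rfl)
  rw [hS] at hL
  simp only [Finset.sum_const, Finset.sum_ite_eq', Finset.mem_univ, if_true] at hL
  linarith

lemma disc3_shift (a b c e : F) :
    disc3 (a + 3 * e) (3 * e ^ 2 + 2 * a * e + b) (e ^ 3 + a * e ^ 2 + b * e + c)
      = disc3 a b c := by
  unfold disc3; ring

lemma S3_shift (a b c e : F) :
    S3 (a + 3 * e) (3 * e ^ 2 + 2 * a * e + b) (e ^ 3 + a * e ^ 2 + b * e + c)
      = S3 a b c := by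
  unfold S3
  refine Fintype.sum_equiv (Equiv.addRight e) _ _ ?_
  intro x
  simp only [Equiv.coe_addRight]
  congr 1; ring

lemma disc4_shift (a b c e : F) :
    disc4 (4 * e) (6 * e ^ 2 + a) (4 * e ^ 3 + 2 * a * e + b) (e ^ 4 + a * e ^ 2 + b * e + c)
      = disc3 a (-4 * c) (b ^ 2 - 4 * a * c) := by
  unfold disc4 disc3; ring

lemma S4_shift (a b c e : F) :
    S4 (4 * e) (6 * e ^ 2 + a) (4 * e ^ 3 + 2 * a * e + b) (e ^ 4 + a * e ^ 2 + b * e + c)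
      = ∑ x : F, quadChar F (x ^ 4 + a * x ^ 2 + b * x + c) := by
  unfold S4
  refine Fintype.sum_equiv (Equiv.addRight e) _ _ ?_
  intro x
  simp only [Equiv.coe_addRight]
  congr 1; ring

lemma m4_dep (h2 : ringChar F ≠ 2) (j : ℕ) :
    m4 F j = ∑ t : F × F × F × F,
      W j t.2.1 (-4 * t.2.2.2) (t.2.2.1 ^ 2 - 4 * t.2.1 * t.2.2.2) := by
  have h2' : (2 : F) ≠ 0 := Ring.two_ne_zero h2
  have h4 : (4 : F) ≠ 0 := by
    have : (4 : F) = 2 * 2 := by norm_num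
    rw [this]; exact mul_ne_zero h2' h2'
  rw [m4_eq]
  symm
  let f : F × F × F × F → F × F × F × F := fun t =>
    (4 * t.1, 6 * t.1 ^ 2 + t.2.1, 4 * t.1 ^ 3 + 2 * t.2.1 * t.1 + t.2.2.1,
      t.1 ^ 4 + t.2.1 * t.1 ^ 2 + t.2.2.1 * t.1 + t.2.2.2)
  have hf : Function.Injective f := by
    rintro ⟨e, a, b, c⟩ ⟨e', a', b', c'⟩ h
    simp only [f, Prod.mk.injEq] at h
    obtain ⟨h1, h2, h3, h5⟩ := h
    obtain rfl := mul_left_cancel₀ h4 h1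
    obtain rfl := add_left_cancel h2
    obtain rfl := add_left_cancel h3
    obtain rfl := add_left_cancel h5
    rfl
  refine Fintype.sum_bijective f (Finite.injective_iff_bijective.1 hf) _ _ ?_
  rintro ⟨e, a, b, c⟩
  simp only [f, W, disc4_shift, S4_shift]
  split_ifs with h
  · rw [key h2]
    rintro ⟨rfl, hc⟩
    apply h
    unfold disc3
    have : (-4 * c) = -a ^ 2 := by linear_combination hc
    have h' : (0:F) ^ 2 - 4 * a * c = - a ^ 3 := by linear_combination a * hc
    rw [this, h']
    ring
  · rfl

lemma m4_cubic (h2 : ringChar F ≠ 2) (j : ℕ) :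
    m4 F j = ∑ t : F × F × F × F,
      W j t.1 t.2.1 (t.2.2.2 ^ 2 - t.2.2.1 ^ 3 - t.1 * t.2.2.1 ^ 2 - t.2.1 * t.2.2.1) := by
  have h2' : (2 : F) ≠ 0 := Ring.two_ne_zero h2
  have h4 : (4 : F) ≠ 0 := by
    have : (4 : F) = 2 * 2 := by norm_num
    rw [this]; exact mul_ne_zero h2' h2'
  rw [m4_dep h2]
  let f : F × F × F × F → F × F × F × F := fun t =>
    (t.2.1 + 3 * t.1, 3 * t.1 ^ 2 + 2 * t.2.1 * t.1 + (-4 * t.2.2.2), -t.2.1 - t.1, t.2.2.1)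
  have hf : Function.Injective f := by
    rintro ⟨e, a, b, c⟩ ⟨e', a', b', c'⟩ h
    simp only [f, Prod.mk.injEq] at h
    obtain ⟨h1, h3, h5, h6⟩ := h
    have he : 2 * e = 2 * e' := by linear_combination h1 + h5
    obtain rfl := mul_left_cancel₀ h2' he
    obtain rfl := add_right_cancel h1
    have h3' := mul_left_cancel₀ (neg_ne_zero.2 h4) (add_left_cancel h3)
    subst h3' h6
    rfl
  refine Fintype.sum_bijective f (Finite.injective_iff_bijective.1 hf) _ _ ?_
  rintro ⟨e, a, b, c⟩
  simp only [f]
  have hc : b ^ 2 - (-a - e) ^ 3 - (a + 3 * e) * (-a - e) ^ 2 -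
      (3 * e ^ 2 + 2 * a * e + (-4 * c)) * (-a - e) =
      e ^ 3 + a * e ^ 2 + (-4 * c) * e + (b ^ 2 - 4 * a * c) := by ring
  rw [hc]
  simp only [W, disc3_shift, S3_shift]

lemma m4_rec (h2 : ringChar F ≠ 2) (j : ℕ) :
    m4 F j = (Fintype.card F : ℤ) * m3 F j + m3 F (j + 1) := by
  have hcount : ∀ a b c : F, ∑ x : F, ∑ y : F,
      (if y ^ 2 = x ^ 3 + a * x ^ 2 + b * x + c then (1 : ℤ) else 0) =
        Fintype.card F + S3 a b c := by
    intro a b c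
    simp only [sqrts h2, Finset.sum_add_distrib, S3]
    simp
  rw [m4_cubic h2, m3_eq, m3_eq, Finset.mul_sum, ← Finset.sum_add_distrib]
  simp only [Fintype.sum_prod_type]
  refine Finset.sum_congr rfl fun a _ => Finset.sum_congr rfl fun b _ => ?_
  have h1 : ∀ c : F, (Fintype.card F : ℤ) * W j a b c + W (j + 1) a b c =
      ∑ x : F, ∑ y : F,
        (if y ^ 2 = x ^ 3 + a * x ^ 2 + b * x + c then W j a b c else 0) := by
    intro c
    have : (Fintype.card F : ℤ) * W j a b c + W (j + 1) a b c =
        (Fintype.card F + S3 a b c) * W j a b c := by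
      unfold W; split_ifs <;> ring
    rw [this, ← hcount, Finset.sum_mul]
    refine Finset.sum_congr rfl fun x _ => ?_
    rw [Finset.sum_mul]
    refine Finset.sum_congr rfl fun y _ => ?_
    split_ifs <;> simp
  simp only [h1]
  conv_rhs => rw [Finset.sum_comm]
  refine Finset.sum_congr rfl fun x _ => ?_
  conv_rhs => rw [Finset.sum_comm]
  refine Finset.sum_congr rfl fun y _ => ?_
  have h3 : ∀ c : F, (y ^ 2 = x ^ 3 + a * x ^ 2 + b * x + c) ↔
      c = y ^ 2 - x ^ 3 - a * x ^ 2 - b * x := by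
    intro c
    constructor
    · intro h; linear_combination -h
    · intro h; linear_combination -h
  simp only [h3]
  simp

lemma m3_odd (h2 : ringChar F ≠ 2) (j : ℕ) (hj : Odd j) : m3 F j = 0 := by
  obtain ⟨d, hd⟩ := quadraticChar_exists_neg_one (F := F) h2
  have hd0 : d ≠ 0 := by rintro rfl; simp at hd
  have hneg : m3 F j = - m3 F j := by
    rw [m3_eq, ← Finset.sum_neg_distrib]
    let f : F × F × F → F × F × F := fun t => (d * t.1, d ^ 2 * t.2.1, d ^ 3 * t.2.2)
    have hf : Function.Injective f := by
      rintro ⟨a, b, c⟩ ⟨a', b', c'⟩ h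
      simp only [f, Prod.mk.injEq] at h
      simpa [hd0] using h
    refine Fintype.sum_bijective f (Finite.injective_iff_bijective.1 hf) _ _ ?_
    rintro ⟨a, b, c⟩
    simp only [f]
    have hD : disc3 (d * a) (d ^ 2 * b) (d ^ 3 * c) = d ^ 6 * disc3 a b c := by
      unfold disc3; ring
    have hS : S3 (d * a) (d ^ 2 * b) (d ^ 3 * c) = - S3 a b c := by
      unfold S3
      rw [← Finset.sum_neg_distrib]
      symm
      refine Fintype.sum_equiv (Equiv.mulLeft₀ d hd0) _ _ ?_
      intro x
      change _ = quadChar F ((d * x) ^ 3 + d * a * (d * x) ^ 2 + d ^ 2 * b * (d * x) + d ^ 3 * c)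
      have : (d * x) ^ 3 + d * a * (d * x) ^ 2 + d ^ 2 * b * (d * x) + d ^ 3 * c =
        d * d * (d * (x ^ 3 + a * x ^ 2 + b * x + c)) := by ring
      rw [this, qc_mul, qc_mul, qc_mul, qc_eq d, hd]
      ring
    have : d ^ 6 * disc3 a b c ≠ 0 ↔ disc3 a b c ≠ 0 := by simp [hd0]
    simp only [W, hD, hS, this, hj.neg_pow]
    split_ifs <;> simp
  linarith

end MomAux

/-- If `q` is an odd prime power not divisible by 3 and `j ≥ 0`, then
`m₄(q;j) = q·m₃(q;j)` for `j` even and `m₄(q;j) = m₃(q;j+1)` for `j` odd. -/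
theorem stmt_0 (F : Type*) [Field F] [Fintype F]
    (hodd : Odd (Fintype.card F)) (h3 : ¬(3 ∣ Fintype.card F)) (j : ℕ) :
    (Even j → m4 F j = (Fintype.card F : ℤ) * m3 F j) ∧
    (Odd j → m4 F j = m3 F (j + 1)) := by
  have h2 : ringChar F ≠ 2 := by
    intro h
    have := FiniteField.even_card_iff_char_two.1 h
    rw [Nat.odd_iff] at hodd
    omega
  constructor
  · intro hj
    rw [MomAux.m4_rec h2, MomAux.m3_odd h2 _ hj.add_one, add_zero]
  · intro hj
    rw [MomAux.m4_rec h2, MomAux.m3_odd h2 _ hj, mul_zero, zero_add]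
end

section
/- Let p > 3 be prime and let k be an integer with 1 ≤ k ≤ 9. Then, as real numbers, (1/(p³−p²)) · Σ_{D∈H_{p,3}} (2 − a_p(D)·p^{−1/2})^k = (2/(k+2))·C(2k+1,k) − 2·Σ_{l=1}^{⌊k/2⌋} C(2k+1, k−2l)·(2l+1)/((k+2l+2)·p^{l+1}). (This is the d=3 moment formula of Theorem 5.1 in the range k ≤ 9, where all the Hecke-trace terms tr_{2l+2}(T_p) vanish because the relevant spaces of cusp forms of weight at most 10 for SL_2(ℤ) are zero.) -/
open Polynomial Finset
open scoped Classical

set_option linter.all false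

section Aux
variable {F : Type*} [Field F] [Fintype F] [DecidableEq F]

/-- polynomials of degree `< n` -/
noncomputable def DL (F : Type*) [Field F] [Fintype F] [DecidableEq F] : ℕ → Finset (Polynomial F)
  | 0 => {0}
  | n + 1 => ((univ : Finset F) ×ˢ DL F n).image (fun z => X * z.2 + C z.1)

/-- monic polynomials of degree `n` -/
noncomputable def Mon (F : Type*) [Field F] [Fintype F] [DecidableEq F] (n : ℕ) : Finset (Polynomial F) :=
  (DL F n).image (fun r => X ^ n + r)

lemma mem_DL (n : ℕ) (r : Polynomial F) : r ∈ DL F n ↔ r.degree < n := by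
  induction n generalizing r with
  | zero =>
    simp [DL]
  | succ n ih =>
    simp only [DL, mem_image, mem_product, mem_univ, true_and, Prod.exists]
    constructor
    · rintro ⟨c, s, hs, rfl⟩
      rw [ih] at hs
      refine (degree_lt_iff_coeff_zero _ _).2 fun m hm => ?_
      obtain ⟨m, rfl⟩ : ∃ k, m = k + 1 := ⟨m - 1, by omega⟩
      simp [coeff_X_mul, coeff_C]
      exact (degree_lt_iff_coeff_zero _ _).1 hs _ (by omega)
    · intro h
      refine ⟨r.coeff 0, r.divX, ?_, ?_⟩
      · rw [ih]
        refine (degree_lt_iff_coeff_zero _ _).2 fun m hm => ?_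
        rw [coeff_divX]
        exact (degree_lt_iff_coeff_zero _ _).1 h _ (by omega)
      · rw [mul_comm]; exact divX_mul_X_add r

lemma inj_XC : Function.Injective (fun z : F × Polynomial F => X * z.2 + C z.1) := by
  rintro ⟨a, r⟩ ⟨b, s⟩ h
  simp only at h
  have h0 : a = b := by simpa using congrArg (eval 0) h
  subst h0
  have := add_right_cancel h
  rw [mul_right_inj' X_ne_zero] at this
  rw [this]

lemma sum_DL_succ {M : Type*} [AddCommMonoid M] (n : ℕ) (f : Polynomial F → M) :
    ∑ r ∈ DL F (n + 1), f r = ∑ c : F, ∑ r ∈ DL F n, f (X * r + C c) := by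
  rw [DL, sum_image (fun x _ y _ h => inj_XC h), sum_product]

lemma card_DL (n : ℕ) : (DL F n).card = Fintype.card F ^ n := by
  induction n with
  | zero => simp [DL]
  | succ n ih => rw [DL, card_image_of_injective _ inj_XC, card_product, ih, pow_succ, mul_comm]; rfl

lemma sum_Mon {M : Type*} [AddCommMonoid M] (n : ℕ) (f : Polynomial F → M) :
    ∑ r ∈ Mon F n, f r = ∑ r ∈ DL F n, f (X ^ n + r) := by
  rw [Mon, sum_image (fun x _ y _ h => add_left_cancel h)]

lemma card_Mon (n : ℕ) : (Mon F n).card = Fintype.card F ^ n := by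
  rw [Mon, card_image_of_injective _ (add_right_injective _), card_DL]

lemma mem_Mon (n : ℕ) (r : Polynomial F) : r ∈ Mon F n ↔ r.Monic ∧ r.natDegree = n := by
  simp only [Mon, mem_image, mem_DL]
  constructor
  · rintro ⟨s, hs, rfl⟩
    refine ⟨monic_X_pow_add hs, ?_⟩
    rw [natDegree_eq_of_degree_eq_some]
    rw [degree_add_eq_left_of_degree_lt] <;> simp [hs]
  · rintro ⟨h1, h2⟩
    refine ⟨r - X ^ n, ?_, by ring⟩
    have hd : r.degree = n := by rw [degree_eq_natDegree h1.ne_zero, h2]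
    rw [← hd]
    apply degree_sub_lt
    · simp [hd]
    · exact h1.ne_zero
    · rw [h1.leadingCoeff]; simp

lemma sum_Mon_succ {M : Type*} [AddCommMonoid M] (n : ℕ) (f : Polynomial F → M) :
    ∑ r ∈ Mon F (n + 1), f r = ∑ c : F, ∑ r ∈ Mon F n, f (X * r + C c) := by
  rw [sum_Mon, sum_DL_succ]
  refine sum_congr rfl fun c _ => ?_
  rw [sum_Mon]
  refine sum_congr rfl fun r _ => ?_
  congr 1
  ring

lemma sum_Mon_zero {M : Type*} [AddCommMonoid M] (f : Polynomial F → M) :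
    ∑ r ∈ Mon F 0, f r = f 1 := by
  rw [sum_Mon]; simp [DL]

/-- nodal weight -/
noncomputable def nw (s : Finset F) (a : F) : F := (∏ b ∈ s.erase a, (a - b))⁻¹

lemma nw_ne_zero (s : Finset F) (a : F) : nw s a ≠ 0 := by
  unfold nw
  refine inv_ne_zero (prod_ne_zero_iff.2 fun b hb => ?_)
  rw [mem_erase] at hb
  exact sub_ne_zero.2 (Ne.symm hb.1)

lemma lag (s : Finset F) (P : Polynomial F) (hP : P.degree < s.card) :
    ∑ a ∈ s, nw s a * P.eval a = P.coeff (s.card - 1) := by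
  have := Lagrange.coeff_eq_sum (s := s) (v := (id : F → F)) (Set.injOn_id _) hP
  rw [this]
  refine sum_congr rfl fun a _ => ?_
  simp [nw, div_eq_mul_inv, mul_comm]

/-- dual moments -/
noncomputable def tj (s : Finset F) (r : Polynomial F) (j : ℕ) : F :=
  ∑ a ∈ s, nw s a * r.eval a * a ^ j

lemma tj_eq (s : Finset F) (r : Polynomial F) (j : ℕ) (hj : j < s.card)
    (hr : r.degree < ((s.card - j : ℕ) : WithBot ℕ)) : tj s r j = r.coeff (s.card - 1 - j) := by
  have h := lag s (r * X ^ j) ?_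
  · rw [tj]
    have e : s.card - 1 = (s.card - 1 - j) + j := by omega
    rw [e, coeff_mul_X_pow] at h
    rw [← h]
    refine sum_congr rfl fun a _ => by simp [mul_assoc]
  · rw [degree_lt_iff_coeff_zero] at hr ⊢
    intro m hm
    rw [show m = (m - j) + j by omega, coeff_mul_X_pow]
    exact hr _ (by omega)

lemma dual_iff (s : Finset F) (d : ℕ) (r : Polynomial F) (hr : r ∈ DL F s.card) :
    (∀ j < d, tj s r j = 0) ↔ r ∈ DL F (s.card - d) := by
  induction d with
  | zero => simpa using hr
  | succ d ih =>
    have : (∀ j < d + 1, tj s r j = 0) ↔ (r ∈ DL F (s.card - d)) ∧ tj s r d = 0 := by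
      rw [← ih]
      constructor
      · intro h; exact ⟨fun j hj => h j (by omega), h d (by omega)⟩
      · rintro ⟨h1, h2⟩ j hj
        rcases Nat.lt_succ_iff_lt_or_eq.1 hj with h | h
        · exact h1 j h
        · rw [h, h2]
    rw [this]
    by_cases hd : d < s.card
    · simp only [mem_DL, degree_lt_iff_coeff_zero]
      constructor
      · rintro ⟨h1, h2⟩ m hm
        rw [tj_eq s r d hd (by rw [degree_lt_iff_coeff_zero]; exact h1)] at h2
        rcases Nat.lt_or_ge m (s.card - d) with h | h
        · rw [show m = s.card - 1 - d by omega]; exact h2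
        · exact h1 m h
      · intro h
        have h1 : ∀ m : ℕ, s.card - d ≤ m → r.coeff m = 0 := fun m hm => h m (by omega)
        refine ⟨h1, ?_⟩
        rw [tj_eq s r d hd (by rw [degree_lt_iff_coeff_zero]; exact h1)]
        exact h _ (by omega)
    · rw [show s.card - d = 0 by omega, show s.card - (d+1) = 0 by omega]
      simp only [DL, mem_singleton, and_iff_left_iff_imp]
      rintro rfl
      simp [tj]

end Aux


section Dual
variable {F : Type*} [Field F] [Fintype F] [DecidableEq F]

/-- complex valued quadratic character -/
noncomputable def qc (F : Type*) [Field F] [Fintype F] [DecidableEq F] : MulChar F ℂ :=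
  (quadraticChar F).ringHomComp (Int.castRingHom ℂ)

lemma qc_apply (a : F) : qc F a = ((quadraticChar F a : ℤ) : ℂ) := rfl

@[simp] lemma qc_zero : qc F 0 = 0 := by rw [qc_apply]; simp

lemma map_sum_ac {ι : Type*} (ψ : AddChar F ℂ) (s : Finset ι) (f : ι → F) :
    ψ (∑ i ∈ s, f i) = ∏ i ∈ s, ψ (f i) := by
  induction s using Finset.induction_on with
  | empty => simp
  | insert x s hx ih => rw [sum_insert hx, prod_insert hx, AddChar.map_add_eq_mul, ih]

lemma qc_ne_one (hF : ringChar F ≠ 2) : qc F ≠ 1 := by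
  obtain ⟨a, ha⟩ := quadraticChar_exists_neg_one' hF
  intro h
  have h1 : qc F a = (1 : MulChar F ℂ) a := by rw [h]
  rw [qc_apply, ha, MulChar.one_apply a.isUnit] at h1
  norm_num at h1

lemma qc_quad : (qc F).IsQuadratic := by
  intro a
  rcases quadraticChar_isQuadratic F a with h | h | h <;> rw [qc_apply, h] <;> simp

lemma gauss_apply (hF : ringChar F ≠ 2) (ψ : AddChar F ℂ) (z : F) :
    ∑ u : F, qc F u * ψ (u * z) = gaussSum (qc F) ψ * qc F z := by
  by_cases hz : z = 0
  · subst hz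
    simp [MulChar.sum_eq_zero_of_ne_one (qc_ne_one hF)]
  · have h := gaussSum_mulShift (qc F) ψ (Units.mk0 z hz)
    have h2 : qc F z * qc F z = 1 := by
      rw [qc_apply, ← Int.cast_mul, ← pow_two, quadraticChar_sq_one hz]; simp
    rw [← h, mul_comm, ← mul_assoc, Units.val_mk0, h2, one_mul]
    simp only [gaussSum, AddChar.mulShift_apply, Units.val_mk0]
    exact sum_congr rfl fun u _ => by rw [mul_comm z u]

/-- character sums over monic polynomials -/
noncomputable def W (d : ℕ) (s : Finset F) : ℤ :=
  ∑ D ∈ Mon F d, ∏ a ∈ s, quadraticChar F (D.eval a)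

lemma stepA (hF : ringChar F ≠ 2) (ψ : AddChar F ℂ) (s : Finset F) (D : Polynomial F) :
    gaussSum (qc F) ψ ^ s.card * ∏ a ∈ s, qc F (D.eval a) =
      ∑ r ∈ DL F s.card, (∏ a ∈ s, qc F (nw s a * r.eval a)) *
        ψ (∑ a ∈ s, nw s a * r.eval a * D.eval a) := by
  rw [← prod_const, ← prod_mul_distrib]
  simp_rw [← gauss_apply hF]
  rw [← prod_coe_sort s, Fintype.prod_sum]
  symm
  refine sum_bij (fun r _ => fun a : s => nw s a * r.eval (a : F)) (fun _ _ => mem_univ _) ?_ ?_ ?_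
  · intro r hr r' hr' h
    rw [mem_DL] at hr hr'
    refine Polynomial.eq_of_degrees_lt_of_eval_finset_eq s hr hr' fun a ha => ?_
    exact mul_left_cancel₀ (nw_ne_zero s a) (congrFun h ⟨a, ha⟩)
  · intro u _
    let v : F → F := fun a => if h : a ∈ s then u ⟨a, h⟩ / nw s a else 0
    refine ⟨Lagrange.interpolate s id v, ?_, ?_⟩
    · rw [mem_DL]; exact Lagrange.degree_interpolate_lt _ (Set.injOn_id _)
    · funext a
      have := Lagrange.eval_interpolate_at_node (s := s) (v := (id : F → F)) v (Set.injOn_id _) a.2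
      simp only [id] at this
      rw [this]
      simp only [v, a.2, dif_pos]
      field_simp [nw_ne_zero s a]
  · intro r _
    rw [prod_mul_distrib, ← prod_coe_sort s]
    congr 1
    rw [← sum_coe_sort s, map_sum_ac]

lemma lin_DL (s : Finset F) (r D : Polynomial F) (d : ℕ) (h : ∀ j < d, tj s r j = 0)
    (hD : D ∈ DL F d) : ∑ a ∈ s, nw s a * r.eval a * D.eval a = 0 := by
  rw [mem_DL] at hD
  have hz : ∀ a, D.eval a = ∑ j ∈ range d, D.coeff j * a ^ j := by
    intro a
    by_cases h0 : D = 0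
    · simp [h0]
    exact eval_eq_sum_range' ((natDegree_lt_iff_degree_lt h0).2 hD) a
  simp_rw [hz, mul_sum]
  rw [sum_comm]
  refine sum_eq_zero fun j hj => ?_
  have := h j (mem_range.1 hj)
  rw [tj] at this
  have e : ∀ a ∈ s, nw s a * r.eval a * (D.coeff j * a ^ j) =
    D.coeff j * (nw s a * r.eval a * a ^ j) := fun a _ => by ring
  rw [sum_congr rfl e, ← mul_sum, this, mul_zero]

lemma stepB (ψ : AddChar F ℂ) (hψ : ψ.IsPrimitive) (s : Finset F) (r : Polynomial F) (d : ℕ) :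
    ∑ D ∈ Mon F d, ψ (∑ a ∈ s, nw s a * r.eval a * D.eval a) =
      if ∀ j < d, tj s r j = 0 then (Fintype.card F : ℂ) ^ d * ψ (tj s r d) else 0 := by
  split_ifs with h
  · rw [sum_Mon]
    have : ∀ D ∈ DL F d, ψ (∑ a ∈ s, nw s a * r.eval a * (X ^ d + D).eval a) = ψ (tj s r d) := by
      intro D hD
      have := lin_DL s r D d h hD
      simp only [eval_add, mul_add, sum_add_distrib, this, add_zero, tj, eval_pow, eval_X]
    rw [sum_congr rfl this, sum_const, card_DL]
    simp
  · push Not at h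
    obtain ⟨j, hj, hne⟩ := h
    obtain ⟨b, hb⟩ : ∃ b, ψ (tj s r j * b) ≠ 1 := by
      have := hψ hne
      rw [AddChar.ne_one_iff] at this
      simpa [AddChar.mulShift_apply] using this
    have key : ∑ D ∈ Mon F d, ψ (∑ a ∈ s, nw s a * r.eval a * D.eval a) =
        ψ (tj s r j * b) * ∑ D ∈ Mon F d, ψ (∑ a ∈ s, nw s a * r.eval a * D.eval a) := by
      have hm : ∀ (c : F), C c * X ^ j ∈ DL F d := by
        intro c
        rw [mem_DL]
        exact lt_of_le_of_lt (degree_C_mul_X_pow_le _ _) (by exact_mod_cast hj)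
      rw [mul_sum, sum_Mon, sum_Mon]
      symm
      refine sum_nbij' (fun D => D + C b * X ^ j) (fun D => D - C b * X ^ j) ?_ ?_ ?_ ?_ ?_
      · intro D hD
        have := hm b
        rw [mem_DL] at *
        exact lt_of_le_of_lt (degree_add_le _ _) (max_lt hD this)
      · intro D hD
        have := hm b
        rw [mem_DL] at *
        exact lt_of_le_of_lt (degree_sub_le _ _) (max_lt hD this)
      · intro D _; ring
      · intro D _; ring
      · intro D _
        rw [← AddChar.map_add_eq_mul]
        congr 1
        rw [tj, sum_mul, ← sum_add_distrib]
        refine sum_congr rfl fun a _ => ?_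
        simp
        ring
    have : (1 - ψ (tj s r j * b)) * ∑ D ∈ Mon F d, ψ (∑ a ∈ s, nw s a * r.eval a * D.eval a) = 0 := by
      rw [sub_mul, one_mul, ← key, sub_self]
    rcases mul_eq_zero.1 this with h | h
    · exact absurd (sub_eq_zero.1 h).symm hb
    · exact h

lemma duality (hF : ringChar F ≠ 2) (ψ : AddChar F ℂ) (hψ : ψ.IsPrimitive) (s : Finset F) (d : ℕ) :
    gaussSum (qc F) ψ ^ s.card * (W d s : ℂ) =
      (Fintype.card F : ℂ) ^ d * ∑ r ∈ DL F (s.card - d),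
        (∏ a ∈ s, qc F (nw s a * r.eval a)) * ψ (tj s r d) := by
  have e : (W d s : ℂ) = ∑ D ∈ Mon F d, ∏ a ∈ s, qc F (D.eval a) := by
    simp [W, qc_apply]
  rw [e, mul_sum]
  simp_rw [stepA hF]
  rw [sum_comm]
  simp_rw [← mul_sum, stepB ψ hψ]
  have hsub : DL F (s.card - d) ⊆ DL F s.card := by
    intro r hr
    rw [mem_DL] at *
    exact lt_of_lt_of_le hr (by exact_mod_cast Nat.sub_le _ _)
  rw [mul_sum, ← sum_subset hsub]
  · refine sum_congr rfl fun r hr => ?_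
    rw [if_pos ((dual_iff s d r (hsub hr)).2 hr)]
    ring
  · intro r hr hn
    rw [if_neg (fun h => hn ((dual_iff s d r hr).1 h)), mul_zero]

lemma W_zero_of_le (hF : ringChar F ≠ 2) (ψ : AddChar F ℂ) (hψ : ψ.IsPrimitive) (s : Finset F)
    (hs : s.Nonempty) (d : ℕ) (hd : s.card ≤ d) : W d s = 0 := by
  have h := duality hF ψ hψ s d
  rw [Nat.sub_eq_zero_of_le hd] at h
  have hg : gaussSum (qc F) ψ ≠ 0 := by
    refine gaussSum_ne_zero_of_nontrivial ?_ (qc_ne_one hF) hψ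
    exact_mod_cast Fintype.card_ne_zero
  have : ∑ r ∈ DL F 0, (∏ a ∈ s, qc F (nw s a * r.eval a)) * ψ (tj s r d) = 0 := by
    simp only [DL, sum_singleton, eval_zero, mul_zero]
    obtain ⟨a, ha⟩ := hs
    rw [prod_eq_zero ha (MulChar.map_zero _), zero_mul]
  rw [this, mul_zero] at h
  rcases mul_eq_zero.1 h with h | h
  · exact absurd h (pow_ne_zero _ hg)
  · exact_mod_cast h

lemma prod_sign (s : Finset F) :
    ∏ a ∈ s, ∏ b ∈ s, (if a = b then (1 : ℤ) else quadraticChar F (a - b)) =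
      quadraticChar F (-1) ^ (s.card * (s.card - 1) / 2) := by
  induction s using Finset.induction_on with
  | empty => simp
  | insert x s hx ih =>
    simp_rw [prod_insert hx]
    rw [prod_mul_distrib, ih, card_insert_of_notMem hx]
    simp only [if_true, one_mul, Nat.add_sub_cancel]
    have : (∏ b ∈ s, if x = b then (1 : ℤ) else quadraticChar F (x - b)) *
       (∏ a ∈ s, if a = x then (1 : ℤ) else quadraticChar F (a - x)) = quadraticChar F (-1) ^ s.card := by
      rw [← prod_mul_distrib, ← prod_const]
      refine prod_congr rfl fun b hb => ?_
      have hne : x ≠ b := fun h => hx (h ▸ hb)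
      rw [if_neg hne, if_neg hne.symm, ← map_mul,
        show (x - b) * (b - x) = (-1) * (x - b) ^ 2 by ring, map_mul,
        quadraticChar_sq_one' (sub_ne_zero.2 hne), mul_one]
    rw [← mul_assoc, this, ← pow_add]
    congr 1
    rw [show (s.card + 1) * s.card = s.card * (s.card - 1) + s.card * 2 by
      cases s.card <;> simp; ring]
    rw [Nat.add_mul_div_right _ _ (by norm_num), add_comm]

lemma prod_nw (s : Finset F) :
    ∏ a ∈ s, qc F (nw s a) = (qc F (-1)) ^ (s.card * (s.card - 1) / 2) := by
  have h := congrArg (Int.cast : ℤ → ℂ) (prod_sign s)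
  rw [qc_apply, ← Int.cast_pow, ← h, Int.cast_prod]
  refine prod_congr rfl fun a ha => ?_
  rw [qc_apply]
  congr 1
  have inv : ∀ z : F, quadraticChar F z⁻¹ = quadraticChar F z := by
    intro z
    by_cases hz : z = 0
    · simp [hz]
    · have h1 : quadraticChar F z⁻¹ * quadraticChar F z = 1 := by
        rw [← map_mul, inv_mul_cancel₀ hz, map_one]
      have h2 := quadraticChar_sq_one hz
      calc _ = quadraticChar F z⁻¹ * quadraticChar F z ^ 2 := by rw [h2, mul_one]
        _ = _ := by rw [pow_two, ← mul_assoc, h1, one_mul]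
  rw [nw, inv, map_prod, ← mul_prod_erase s _ ha, if_pos rfl, one_mul]
  refine prod_congr rfl fun b hb => ?_
  rw [if_neg (Ne.symm (mem_erase.1 hb).1)]

/-- odd dual sum -/
lemma dual_odd (hF : ringChar F ≠ 2) (ψ : AddChar F ℂ) (s : Finset F) (hs : Odd s.card) (k : ℕ) :
    ∑ r ∈ DL F (k + 1), (∏ a ∈ s, qc F (r.eval a)) * ψ (r.coeff k) =
      gaussSum (qc F) ψ * (W k s : ℂ) := by
  have hsc : ∀ (c : F) (r : Polynomial F), ∏ a ∈ s, qc F ((C c * r).eval a) =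
      qc F c * ∏ a ∈ s, qc F (r.eval a) := by
    intro c r
    simp only [eval_mul, eval_C, map_mul, prod_mul_distrib, prod_const]
    congr 1
    by_cases hc : c = 0
    · simp [hc, hs.pos.ne']
    · obtain ⟨l, hl⟩ := hs
      rw [hl, pow_succ, pow_mul, qc_apply, ← Int.cast_pow, quadraticChar_sq_one hc]; simp
  have split : ∀ f : Polynomial F → ℂ, ∑ r ∈ DL F (k + 1), f r =
      ∑ r ∈ DL F k, f r + ∑ c ∈ univ.filter (fun c : F => c ≠ 0), ∑ D ∈ Mon F k, f (C c * D) := by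
    intro f
    rw [← sum_filter_add_sum_filter_not (DL F (k + 1)) (fun r => r.coeff k = 0)]
    congr 1
    · refine sum_congr ?_ fun _ _ => rfl
      ext r
      simp only [mem_filter, mem_DL, degree_lt_iff_coeff_zero]
      constructor
      · rintro ⟨h1, h2⟩ m hm
        rcases Nat.eq_or_lt_of_le hm with h | h
        · rw [← h]; exact h2
        · exact h1 m h
      · intro h
        exact ⟨fun m hm => h m (by omega), h k le_rfl⟩
    · rw [← sum_product']
      symm
      refine sum_bij (fun z _ => C z.1 * z.2) ?_ ?_ ?_ ?_
      · rintro ⟨c, D⟩ h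
        simp only [mem_product, mem_filter, mem_univ, true_and, mem_Mon] at h
        have hn : D.coeff k = 1 := by rw [← h.2.2]; exact h.2.1
        simp only [mem_filter, mem_DL, coeff_C_mul, hn, mul_one]
        refine ⟨?_, h.1⟩
        rw [degree_C_mul h.1, degree_eq_natDegree h.2.1.ne_zero, h.2.2]
        exact_mod_cast Nat.lt_succ_self k
      · rintro ⟨c, D⟩ h ⟨c', D'⟩ h' e
        simp only [mem_product, mem_filter, mem_univ, true_and, mem_Mon] at h h' e
        have hc : c = c' := by
          have := congrArg leadingCoeff e
          simpa [h.2.1.leadingCoeff, h'.2.1.leadingCoeff] using this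
        subst hc
        rw [mul_right_inj' (C_ne_zero.2 h.1)] at e
        rw [e]
      · intro r h
        simp only [mem_filter, mem_DL] at h
        have h0 : r ≠ 0 := by rintro rfl; simp at h
        have hd : r.natDegree = k := by
          refine le_antisymm ?_ (le_natDegree_of_ne_zero h.2)
          have := (natDegree_lt_iff_degree_lt h0).2 h.1
          omega
        have hl : r.leadingCoeff ≠ 0 := leadingCoeff_ne_zero.2 h0
        refine ⟨(r.leadingCoeff, r * C r.leadingCoeff⁻¹), ?_, ?_⟩
        · simp only [mem_product, mem_filter, mem_univ, true_and, mem_Mon]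
          refine ⟨hl, monic_mul_leadingCoeff_inv h0, ?_⟩
          rw [natDegree_mul_C (inv_ne_zero hl), hd]
        · simp only
          rw [mul_comm r, ← mul_assoc, ← C_mul, mul_inv_cancel₀ hl, C_1, one_mul]
      · intros; rfl
  rw [split]
  have z1 : ∑ r ∈ DL F k, (∏ a ∈ s, qc F (r.eval a)) * ψ (r.coeff k) = 0 := by
    obtain ⟨n, hn⟩ := quadraticChar_exists_neg_one' hF
    have e1 : ∑ r ∈ DL F k, (∏ a ∈ s, qc F (r.eval a)) * ψ (r.coeff k) =
        ∑ r ∈ DL F k, (∏ a ∈ s, qc F (r.eval a)) := by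
      refine sum_congr rfl fun r hr => ?_
      rw [mem_DL, degree_lt_iff_coeff_zero] at hr
      rw [hr k le_rfl]; simp
    rw [e1]
    have e2 : ∑ r ∈ DL F k, (∏ a ∈ s, qc F (r.eval a)) =
        - ∑ r ∈ DL F k, (∏ a ∈ s, qc F (r.eval a)) := by
      rw [← sum_neg_distrib]
      symm
      refine sum_nbij' (fun r => C (n : F) * r) (fun r => C (n : F)⁻¹ * r) ?_ ?_ ?_ ?_ ?_
      · intro r hr; rw [mem_DL] at *; rwa [degree_C_mul n.ne_zero]
      · intro r hr; rw [mem_DL] at *; rwa [degree_C_mul (inv_ne_zero n.ne_zero)]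
      · intro r _
        rw [← mul_assoc, ← C_mul, inv_mul_cancel₀ n.ne_zero, C_1, one_mul]
      · intro r _
        rw [← mul_assoc, ← C_mul, mul_inv_cancel₀ n.ne_zero, C_1, one_mul]
      · intro r _
        rw [hsc, qc_apply, hn]; simp
    have : (2 : ℂ) * ∑ r ∈ DL F k, (∏ a ∈ s, qc F (r.eval a)) = 0 := by
      linear_combination e2
    simpa using this
  rw [z1, zero_add]
  have e3 : ∀ c ∈ univ.filter (fun c : F => c ≠ 0), ∑ D ∈ Mon F k,
      (∏ a ∈ s, qc F ((C c * D).eval a)) * ψ ((C c * D).coeff k) = qc F c * ψ c * (W k s : ℂ) := by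
    intro c _
    rw [W, Int.cast_sum, mul_sum]
    refine sum_congr rfl fun D hD => ?_
    rw [mem_Mon] at hD
    have hn : D.coeff k = 1 := by rw [← hD.2]; exact hD.1
    rw [hsc, coeff_C_mul, hn, mul_one, Int.cast_prod]
    simp only [qc_apply]
    ring
  rw [sum_congr rfl e3, ← sum_mul, gaussSum]
  congr 1
  refine sum_subset (subset_univ _) fun c _ hc => ?_
  have : c = 0 := by simpa using hc
  rw [this]; simp

/-- functional equation -/
lemma W_fe (hF : ringChar F ≠ 2) (ψ : AddChar F ℂ) (hψ : ψ.IsPrimitive) (s : Finset F) (l d k : ℕ)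
    (hs : s.card = 2 * l + 1) (hk : d + k = 2 * l) :
    (Fintype.card F : ℤ) ^ l * W d s = (Fintype.card F : ℤ) ^ d * W k s := by
  have hodd : Odd s.card := ⟨l, hs⟩
  have h := duality hF ψ hψ s d
  have hg : gaussSum (qc F) ψ ≠ 0 := by
    refine gaussSum_ne_zero_of_nontrivial ?_ (qc_ne_one hF) hψ
    exact_mod_cast Fintype.card_ne_zero
  have hg2 := gaussSum_sq (qc_ne_one hF) qc_quad hψ
  have e : ∑ r ∈ DL F (s.card - d), (∏ a ∈ s, qc F (nw s a * r.eval a)) * ψ (tj s r d) =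
      (qc F (-1)) ^ (s.card * (s.card - 1) / 2) * (gaussSum (qc F) ψ * (W k s : ℂ)) := by
    rw [← dual_odd hF ψ s hodd, mul_sum, show s.card - d = k + 1 by omega]
    refine sum_congr rfl fun r hr => ?_
    rw [tj_eq s r d (by omega) (by rw [show s.card - d = k + 1 by omega]; exact (mem_DL _ _).1 hr),
      show s.card - 1 - d = k by omega]
    simp only [map_mul, prod_mul_distrib, prod_nw]
    ring
  rw [e, hs, pow_succ, pow_mul, hg2, show (2 * l + 1) * (2 * l + 1 - 1) / 2 = 2 * l * l + l by
    rw [show (2 * l + 1) * (2 * l + 1 - 1) = (2 * l * l + l) * 2 by simp; ring]; simp,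
    pow_add, mul_pow] at h
  have hm1 : qc F (-1) ^ 2 = 1 := by
    rw [qc_apply, ← Int.cast_pow, quadraticChar_sq_one (neg_ne_zero.2 one_ne_zero)]; simp
  rw [mul_assoc 2 l l, pow_mul, hm1, one_pow, one_mul] at h
  have hm1' : qc F (-1) ^ l ≠ 0 := by
    apply pow_ne_zero
    intro h0; rw [h0] at hm1; norm_num at hm1
  have h2 : (Fintype.card F : ℂ) ^ l * (W d s : ℂ) = (Fintype.card F : ℂ) ^ d * (W k s : ℂ) := by
    apply mul_left_cancel₀ (mul_ne_zero hm1' hg)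
    linear_combination h
  exact_mod_cast h2

end Dual


section Newton
variable {F : Type*} [Field F] [Fintype F] [DecidableEq F]

/-- elementary symmetric sums -/
noncomputable def ee (m : ℕ) (f : F → ℤ) : ℤ := ∑ s ∈ powersetCard m (univ : Finset F), ∏ a ∈ s, f a

lemma newton (k : ℕ) (f : F → ℤ) : (k : ℤ) * ee k f = (-1) ^ (k + 1) *
      ∑ a ∈ antidiagonal k with a.1 < k, (-1) ^ a.1 * ee a.1 f * ∑ x, f x ^ a.2 := by
  have h := congrArg (MvPolynomial.aeval f) (MvPolynomial.mul_esymm_eq_sum F ℤ k)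
  simp only [map_mul, map_pow, map_neg, map_one, map_sum, MvPolynomial.esymm, MvPolynomial.psum,
    map_prod, MvPolynomial.aeval_X, map_natCast] at h
  exact h

/-- the polynomials `m! e_m` in terms of `S` and `Z` -/
def EE : ℕ → ℤ → ℤ → ℤ
  | 0, _, _ => 1
  | 1, S, _ => S
  | m + 2, S, Z => S * EE (m + 1) S Z - (m + 1) * (Z - m) * EE m S Z

lemma ee_all (f : F → ℤ) (S Z : ℤ) (h3 : ∀ x, f x ^ 3 = f x) (hS : ∑ x, f x = S)
    (hZ : ∑ x, f x ^ 2 = Z) :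
    ee 1 f = EE 1 S Z ∧ 6 * ee 3 f = EE 3 S Z ∧ 120 * ee 5 f = EE 5 S Z ∧
      5040 * ee 7 f = EE 7 S Z := by
  have p3 : ∑ x, f x ^ 3 = S := by simp_rw [h3]; exact hS
  have q4 : ∀ x, f x ^ 4 = f x ^ 2 := fun x => by rw [pow_succ, h3, pow_two]
  have q5 : ∀ x, f x ^ 5 = f x := fun x => by
    rw [pow_succ, q4, ← pow_succ, h3]
  have p4 : ∑ x, f x ^ 4 = Z := by simp_rw [q4]; exact hZ
  have p5 : ∑ x, f x ^ 5 = S := by simp_rw [q5]; exact hS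
  have q6 : ∀ x, f x ^ 6 = f x ^ 2 := fun x => by rw [pow_succ, q5, pow_two]
  have q7 : ∀ x, f x ^ 7 = f x := fun x => by rw [pow_succ, q6, ← pow_succ, h3]
  have p6 : ∑ x, f x ^ 6 = Z := by simp_rw [q6]; exact hZ
  have p7 : ∑ x, f x ^ 7 = S := by simp_rw [q7]; exact hS
  have e0 : ee 0 f = 1 := by simp [ee]
  have n1 := newton 1 f
  have n2 := newton 2 f
  have n3 := newton 3 f
  have n4 := newton 4 f
  have n5 := newton 5 f
  have n6 := newton 6 f
  have n7 := newton 7 f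
  simp only [sum_filter, Nat.sum_antidiagonal_eq_sum_range_succ_mk, sum_range_succ, range_zero,
    sum_empty, Nat.reduceAdd, Nat.reduceSub, Nat.reduceLT, if_true, if_false, pow_one, hS, hZ, p3, p4, p5, p6,
    p7, e0, lt_irrefl] at n1 n2 n3 n4 n5 n6 n7
  norm_num [hS] at n1 n2 n3 n4 n5 n6 n7
  have a2 : 2 * ee 2 f = EE 2 S Z := by simp [EE]; rw [n2, n1]; ring
  have a3 : 6 * ee 3 f = EE 3 S Z := by
    simp [EE] at a2 ⊢
    linear_combination 2 * n3 + S * a2  - 2 * Z * n1 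
  have a4 : 24 * ee 4 f = EE 4 S Z := by
    simp [EE] at a2 a3 ⊢
    linear_combination 6 * n4 + S * a3 - 3 * Z * a2 + 6 * S * n1
  have a5 : 120 * ee 5 f = EE 5 S Z := by
    simp [EE] at a2 a3 a4 ⊢
    linear_combination 24 * n5 + S * a4 - 4 * Z * a3 + 12 * S * a2 - 24 * Z * n1
  have a6 : 720 * ee 6 f = EE 6 S Z := by
    simp [EE] at a2 a3 a4 a5 ⊢
    linear_combination 120 * n6 + S * a5 - 5 * Z * a4 + 20 * S * a3 - 60 * Z * a2 + 120 * S * n1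
  have a7 : 5040 * ee 7 f = EE 7 S Z := by
    simp [EE] at a2 a3 a4 a5 a6 ⊢
    linear_combination 720 * n7 + S * a6 - 6 * Z * a5 + 30 * S * a4 - 120 * Z * a3 + 360 * S * a2 - 720 * Z * n1
  exact ⟨by simp [EE, n1], a3, a5, a7⟩

/-- character sum of a polynomial -/
noncomputable def SS (D : Polynomial F) : ℤ := ∑ x : F, quadraticChar F (D.eval x)

/-- rational zeros -/
noncomputable def zer (D : Polynomial F) : Finset F := univ.filter (fun x => D.eval x = 0)

/-- elementary symmetric sums of character values -/
noncomputable def eD (m : ℕ) (D : Polynomial F) : ℤ := ee m (fun x => quadraticChar F (D.eval x))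

lemma qc_cube (a : F) : quadraticChar F a ^ 3 = quadraticChar F a := by
  rcases quadraticChar_isQuadratic F a with h | h | h <;> rw [h] <;> norm_num

lemma ZZ (D : Polynomial F) : ∑ x : F, quadraticChar F (D.eval x) ^ 2 =
    Fintype.card F - (zer D).card := by
  have : ∀ x : F, quadraticChar F (D.eval x) ^ 2 = 1 - if D.eval x = 0 then 1 else 0 := by
    intro x
    split_ifs with h
    · rw [h]; simp
    · rw [quadraticChar_sq_one h]; simp
  simp_rw [this]
  rw [sum_sub_distrib, ← sum_filter]
  simp [zer]

lemma eD_all (D : Polynomial F) (Z : ℤ) (hZ : Z = Fintype.card F - (zer D).card) :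
    eD 1 D = EE 1 (SS D) Z ∧ 6 * eD 3 D = EE 3 (SS D) Z ∧
    120 * eD 5 D = EE 5 (SS D) Z ∧ 5040 * eD 7 D = EE 7 (SS D) Z :=
  ee_all _ _ _ (fun x => qc_cube _) rfl ((ZZ D).trans hZ.symm)

/-- nodal polynomial -/
noncomputable def nod (s : Finset F) : Polynomial F := ∏ c ∈ s, (X - C c)

lemma nod_monic (s : Finset F) : (nod s).Monic := monic_prod_of_monic _ _ fun c _ => monic_X_sub_C c

lemma nod_natDegree (s : Finset F) : (nod s).natDegree = s.card := by
  rw [nod, natDegree_prod_of_monic _ _ fun c _ => monic_X_sub_C c]; simp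

lemma nod_dvd (s : Finset F) (D : Polynomial F) (h : s ⊆ zer D) : nod s ∣ D := by
  refine Finset.prod_dvd_of_coprime ?_ ?_
  · intro a _ b _ hab
    exact (pairwise_coprime_X_sub_C (s := (id : F → F)) Function.injective_id) hab
  · intro a ha
    have := h ha
    rw [zer, mem_filter] at this
    exact dvd_iff_isRoot.2 this.2

lemma sum_vanish (s : Finset F) (d : ℕ) (hd : s.card ≤ d) (f : Polynomial F → ℤ) :
    ∑ D ∈ Mon F d, (if s ⊆ zer D then f D else 0) = ∑ D ∈ Mon F (d - s.card), f (nod s * D) := by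
  rw [← sum_filter]
  symm
  refine sum_bij (fun D _ => nod s * D) ?_ ?_ ?_ ?_
  · intro D hD
    rw [mem_Mon] at hD
    rw [mem_filter, mem_Mon]
    refine ⟨⟨(nod_monic s).mul hD.1, ?_⟩, ?_⟩
    · rw [(nod_monic s).natDegree_mul hD.1, nod_natDegree, hD.2]; omega
    · intro a ha
      rw [zer, mem_filter]
      refine ⟨mem_univ _, ?_⟩
      rw [eval_mul, nod, eval_prod, prod_eq_zero ha (by simp), zero_mul]
  · intro D _ D' _ h
    exact mul_left_cancel₀ (nod_monic s).ne_zero h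
  · intro D hD
    rw [mem_filter, mem_Mon] at hD
    obtain ⟨E, rfl⟩ := nod_dvd s D hD.2
    have hm := (nod_monic s).of_mul_monic_left hD.1.1
    refine ⟨E, ?_, rfl⟩
    rw [mem_Mon]
    refine ⟨hm, ?_⟩
    have := hD.1.2
    rw [(nod_monic s).natDegree_mul hm, nod_natDegree] at this
    omega
  · intros; rfl

lemma choose_sum (D : Polynomial F) (k : ℕ) :
    (((zer D).card.choose k : ℕ) : ℤ) = ∑ s ∈ powersetCard k (univ : Finset F), if s ⊆ zer D then 1 else 0 := by
  rw [← card_powersetCard, ← sum_filter]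
  simp only [sum_const, nsmul_eq_mul, mul_one]
  congr 2
  ext s
  simp only [mem_powersetCard, mem_filter]
  constructor
  · rintro ⟨h1, h2⟩; exact ⟨⟨subset_univ _, h2⟩, h1⟩
  · rintro ⟨⟨_, h2⟩, h1⟩; exact ⟨h1, h2⟩

lemma tmk (d k m : ℕ) (hk : k ≤ d) :
    ∑ D ∈ Mon F d, (((zer D).card.choose k : ℕ) : ℤ) * eD m D =
      ∑ c ∈ powersetCard k (univ : Finset F), ∑ s ∈ powersetCard m (univ : Finset F),
        (∏ a ∈ s, quadraticChar F ((nod c).eval a)) * W (d - k) s := by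
  simp_rw [choose_sum, sum_mul]
  rw [sum_comm]
  refine sum_congr rfl fun c hc => ?_
  have hc' := (mem_powersetCard.1 hc).2
  have := sum_vanish c d (by omega) (fun D => eD m D)
  simp only [ite_mul, one_mul, zero_mul]
  rw [this, hc']
  simp only [eD, ee]
  rw [sum_comm]
  refine sum_congr rfl fun s _ => ?_
  rw [W, mul_sum]
  refine sum_congr rfl fun D _ => ?_
  simp only [eval_mul, map_mul, prod_mul_distrib]

end Newton


section Quad
variable {F : Type*} [Field F] [Fintype F] [DecidableEq F]

lemma two_ne (hF : ringChar F ≠ 2) : (2 : F) ≠ 0 := Ring.two_ne_zero hF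

lemma card_sq (hF : ringChar F ≠ 2) (u : F) :
    (((univ : Finset F).filter (fun x => x ^ 2 = u)).card : ℤ) = 1 + quadraticChar F u := by
  rw [add_comm, ← quadraticChar_card_sqrts hF u]
  congr 2
  ext x
  simp

lemma sum_sq (hF : ringChar F ≠ 2) (g : F → ℤ) :
    ∑ x : F, g (x ^ 2) = ∑ u : F, (1 + quadraticChar F u) * g u := by
  rw [← Finset.sum_fiberwise (univ : Finset F) (fun x : F => x ^ 2)]
  refine sum_congr rfl fun u _ => ?_
  rw [← card_sq hF, sum_congr rfl (g := fun _ => g u)]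
  · simp
  · intro x hx
    rw [(mem_filter.1 hx).2]

lemma chi_sum (hF : ringChar F ≠ 2) : ∑ x : F, quadraticChar F x = 0 := quadraticChar_sum_zero hF

lemma chi_jac (hF : ringChar F ≠ 2) (δ : F) (hδ : δ ≠ 0) :
    ∑ u : F, quadraticChar F u * quadraticChar F (u - δ) = -1 := by
  have h := jacobiSum_nontrivial_inv (quadraticChar_ne_one hF)
  rw [(quadraticChar_isQuadratic F).inv] at h
  rw [jacobiSum] at h
  have e := Equiv.sum_comp (Equiv.mulLeft₀ δ hδ) (fun u => quadraticChar F u * quadraticChar F (u - δ))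
  rw [← e]
  have : ∀ v : F, quadraticChar F (δ * v) * quadraticChar F (δ * v - δ) =
      quadraticChar F (-1) * (quadraticChar F v * quadraticChar F (1 - v)) := by
    intro v
    have h1 : δ * v - δ = δ * ((-1) * (1 - v)) := by ring
    have h2 := quadraticChar_sq_one hδ
    rw [h1, map_mul, map_mul, map_mul]
    linear_combination (quadraticChar F v * quadraticChar F (-1) * quadraticChar F (1 - v)) * h2
  refine (sum_congr rfl (fun v _ => this v)).trans ?_
  rw [← mul_sum, h]
  have h3 := quadraticChar_sq_one (F := F) (a := -1) (by simp)
  linear_combination - h3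

lemma chi_shift (hF : ringChar F ≠ 2) (δ : F) :
    ∑ x : F, quadraticChar F (x ^ 2 - δ) = -1 + Fintype.card F * (1 - quadraticChar F δ ^ 2) := by
  rw [sum_sq hF (fun u => quadraticChar F (u - δ))]
  simp_rw [add_mul, one_mul]
  rw [sum_add_distrib]
  have h0 : ∑ u : F, quadraticChar F (u - δ) = 0 := by
    rw [← chi_sum hF]
    exact Equiv.sum_comp (Equiv.subRight δ) (fun u => quadraticChar F u)
  rw [h0, zero_add]
  by_cases hδ : δ = 0
  · subst hδ
    simp only [sub_zero, ← pow_two]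
    have := ZZ (X : Polynomial F)
    simp only [eval_X] at this
    rw [this]
    have h1 : zer (X : Polynomial F) = {0} := by ext x; simp [zer]
    rw [h1]; simp; ring
  · rw [chi_jac hF δ hδ, quadraticChar_sq_one hδ]; simp

lemma quad_vals (hF : ringChar F ≠ 2) (b c δ : F) (hδ : δ = (b / 2) ^ 2 - c) (D : Polynomial F)
    (hD : ∀ x, D.eval x = x ^ 2 + b * x + c) :
    SS D = -1 + Fintype.card F * (1 - quadraticChar F δ ^ 2) ∧
    ((zer D).card : ℤ) = 1 + quadraticChar F δ := by
  have h2 := two_ne hF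
  have key : ∀ x, D.eval x = (x + b / 2) ^ 2 - δ := by
    intro x; rw [hD, hδ]; field_simp; ring
  constructor
  · rw [SS, ← chi_shift hF]
    simp_rw [key]
    exact Equiv.sum_comp (Equiv.addRight (b/2)) (fun x => quadraticChar F (x ^ 2 - δ))
  · rw [← card_sq hF]
    congr 1
    refine card_bij (fun x _ => x + b / 2) ?_ ?_ ?_
    · intro x hx
      simp only [zer, mem_filter, key, mem_univ, true_and] at hx ⊢
      exact sub_eq_zero.1 hx
    · intro x _ y _ h; exact add_right_cancel h
    · intro y hy
      refine ⟨y - b / 2, ?_, by ring⟩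
      simp only [zer, mem_filter, key, mem_univ, true_and] at hy ⊢
      rw [← hy]; ring

lemma sum_chi_phi (hF : ringChar F ≠ 2) (φ : ℤ → ℤ) :
    2 * ∑ δ : F, φ (quadraticChar F δ) = 2 * φ 0 + (Fintype.card F - 1) * (φ 1 + φ (-1)) := by
  have h : ∀ δ : F, 2 * φ (quadraticChar F δ) = 2 * φ 0 + quadraticChar F δ ^ 2 * (φ 1 + φ (-1) - 2 * φ 0)
      + quadraticChar F δ * (φ 1 - φ (-1)) := by
    intro δ
    rcases quadraticChar_isQuadratic F δ with h | h | h <;> rw [h] <;> ring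
  rw [mul_sum]
  simp_rw [h]
  rw [sum_add_distrib, sum_add_distrib, ← sum_mul _ _ (φ 1 - φ (-1)), ← sum_mul _ _ (φ 1 + φ (-1) - 2 * φ 0), chi_sum hF]
  have := ZZ (X : Polynomial F)
  simp only [eval_X] at this
  have h1 : zer (X : Polynomial F) = {0} := by ext x; simp [zer]
  rw [this, h1]
  simp
  ring

lemma sum_Mon_two (hF : ringChar F ≠ 2) (Φ : ℤ → ℤ → ℤ) :
    ∑ Q ∈ Mon F 2, Φ (SS Q) (zer Q).card = Fintype.card F *
      ∑ δ : F, Φ (-1 + Fintype.card F * (1 - quadraticChar F δ ^ 2)) (1 + quadraticChar F δ) := by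
  rw [sum_Mon_succ, sum_comm' (t' := Mon F 1) (s' := fun _ => univ) (by simp), sum_Mon_succ]
  simp_rw [sum_Mon_zero]
  rw [← nsmul_eq_mul, ← card_univ, ← sum_const]
  refine sum_congr rfl fun b _ => ?_
  rw [← Equiv.sum_comp (Equiv.subLeft ((b/2)^2))]
  refine sum_congr rfl fun c _ => ?_
  obtain ⟨h1, h2⟩ := quad_vals hF b ((b/2)^2 - c) c (by ring) (X * (X * 1 + C b) + C ((b/2)^2 - c)) (by
    intro x; simp; ring)
  rw [Equiv.subLeft_apply, h1, h2]
  simp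

end Quad


section Odd
variable {F : Type*} [Field F] [Fintype F] [DecidableEq F]

/-- mixed sums over monic quartics -/
noncomputable def tt (F : Type*) [Field F] [Fintype F] [DecidableEq F] (m k : ℕ) : ℤ :=
  ∑ D ∈ Mon F 4, (((zer D).card.choose k : ℕ) : ℤ) * eD m D

lemma tt_zero (hF : ringChar F ≠ 2) (ψ : AddChar F ℂ) (hψ : ψ.IsPrimitive) (m k : ℕ) (hm : 1 ≤ m)
    (h : m + k ≤ 4) : tt F m k = 0 := by
  rw [tt, tmk 4 k m (by omega)]
  refine sum_eq_zero fun c _ => sum_eq_zero fun s hs => ?_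
  have hs' := (mem_powersetCard.1 hs).2
  rw [W_zero_of_le hF ψ hψ s (card_pos.1 (by omega)) _ (by omega), mul_zero]

lemma W0 (s : Finset F) : W 0 s = 1 := by
  rw [W, sum_Mon_zero]; simp

lemma q_ne : (Fintype.card F : ℤ) ≠ 0 := by
  exact_mod_cast Fintype.card_ne_zero

lemma nod_empty : nod (∅ : Finset F) = 1 := by simp [nod]

lemma tt50 (hF : ringChar F ≠ 2) (ψ : AddChar F ℂ) (hψ : ψ.IsPrimitive) :
    120 * tt F 5 0 = (Fintype.card F : ℤ) ^ 2 * EE 5 (Fintype.card F) (Fintype.card F) := by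
  rw [tt, tmk 4 0 5 (by omega), powersetCard_zero, sum_singleton, nod_empty]
  have h := (ee_all (F := F) (fun _ => 1) (Fintype.card F) (Fintype.card F) (by simp) (by simp) (by simp)).2.2.1
  rw [← h, ee]
  have : ∀ s ∈ powersetCard 5 (univ : Finset F), (∏ a ∈ s, quadraticChar F ((1 : Polynomial F).eval a)) * W (4 - 0) s
      = (Fintype.card F : ℤ) ^ 2 * ∏ a ∈ s, 1 := by
    intro s hs
    have hs' := (mem_powersetCard.1 hs).2
    have w := W_fe hF ψ hψ s 2 4 0 hs' rfl
    rw [W0] at w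
    have : W 4 s = (Fintype.card F : ℤ) ^ 2 := by
      have hq := pow_ne_zero 2 (q_ne (F := F))
      apply mul_left_cancel₀ hq
      rw [w]; ring
    simp [this]
  rw [sum_congr rfl this, ← mul_sum]
  ring

lemma tt70 (hF : ringChar F ≠ 2) (ψ : AddChar F ℂ) (hψ : ψ.IsPrimitive) :
    tt F 7 0 = (Fintype.card F : ℤ) * ∑ Q ∈ Mon F 2, eD 7 Q := by
  rw [tt, tmk 4 0 7 (by omega), powersetCard_zero, sum_singleton, nod_empty]
  simp only [eD, ee]
  rw [sum_comm, mul_sum]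
  refine sum_congr rfl fun s hs => ?_
  have hs' := (mem_powersetCard.1 hs).2
  have w := W_fe hF ψ hψ s 3 4 2 hs' rfl
  have : W 4 s = (Fintype.card F : ℤ) * W 2 s := by
    have hq := pow_ne_zero 3 (q_ne (F := F))
    apply mul_left_cancel₀ hq
    rw [w]; ring
  simp only [Nat.sub_zero, this, eval_one, map_one, prod_const_one, one_mul]
  rfl

lemma tt32 (hF : ringChar F ≠ 2) (ψ : AddChar F ℂ) (hψ : ψ.IsPrimitive) :
    tt F 3 2 = (Fintype.card F : ℤ) * ∑ c ∈ powersetCard 2 (univ : Finset F), eD 3 (nod c) := by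
  rw [tt, tmk 4 2 3 (by omega), mul_sum]
  refine sum_congr rfl fun c _ => ?_
  rw [eD, ee, mul_sum]
  refine sum_congr rfl fun s hs => ?_
  have hs' := (mem_powersetCard.1 hs).2
  have w := W_fe hF ψ hψ s 1 2 0 hs' rfl
  rw [W0] at w
  have : W 2 s = (Fintype.card F : ℤ) := by
    have hq := pow_ne_zero 1 (q_ne (F := F))
    apply mul_left_cancel₀ hq
    rw [w]; ring
  simp [this]
  ring

lemma tt51 (hF : ringChar F ≠ 2) (ψ : AddChar F ℂ) (hψ : ψ.IsPrimitive) :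
    tt F 5 1 = (Fintype.card F : ℤ) * ∑ c : F, ∑ r : F, eD 5 ((X - C c) * (X - C r)) := by
  rw [tt, tmk 4 1 5 (by omega), mul_sum, powersetCard_one, sum_map]
  refine sum_congr rfl fun c _ => ?_
  simp only [eD, ee]
  rw [sum_comm, mul_sum]
  refine sum_congr rfl fun s hs => ?_
  have hs' := (mem_powersetCard.1 hs).2
  have w := W_fe hF ψ hψ s 2 3 1 hs' rfl
  have : W 3 s = (Fintype.card F : ℤ) * W 1 s := by
    have hq := pow_ne_zero 2 (q_ne (F := F))
    apply mul_left_cancel₀ hq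
    rw [w]; ring
  simp only [Nat.reduceSub, this]
  rw [W, sum_Mon_succ]
  simp_rw [sum_Mon_zero]
  rw [← Equiv.sum_comp (Equiv.neg F)]
  rw [mul_left_comm, mul_sum]
  congr 1
  refine sum_congr rfl fun r _ => ?_
  rw [← prod_mul_distrib]
  refine prod_congr rfl fun a _ => ?_
  rw [← map_mul]
  congr 1
  simp [nod]
  left; ring

/-- odd moments over quartics -/
noncomputable def RR (F : Type*) [Field F] [Fintype F] [DecidableEq F] (n : ℕ) : ℤ :=
  ∑ D ∈ Mon F 4, SS D ^ n

lemma ch2 (N : ℕ) : (N : ℤ) ^ 2 = 2 * (N.choose 2 : ℕ) + N := by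
  induction N with
  | zero => simp
  | succ n ih =>
    rw [Nat.choose_succ_succ' n 1]; push_cast; simp; linear_combination ih

lemma ch3 (N : ℕ) : (N : ℤ) ^ 3 = 6 * (N.choose 3 : ℕ) + 6 * (N.choose 2 : ℕ) + N := by
  induction N with
  | zero => simp
  | succ n ih =>
    rw [Nat.choose_succ_succ' n 2, Nat.choose_succ_succ' n 1]; push_cast; simp; linear_combination ih + 3 * ch2 n

lemma RR_formula :
    RR F 1 = tt F 1 0 ∧
    RR F 3 = 6 * tt F 3 0 + (3 * Fintype.card F - 2) * tt F 1 0 - 3 * tt F 1 1 ∧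
    RR F 5 = 120 * tt F 5 0 + 6 * ((10 * Fintype.card F - 20) * tt F 3 0 - 10 * tt F 3 1)
      + ((15 * (Fintype.card F : ℤ) ^ 2 - 30 * Fintype.card F + 16) * tt F 1 0
      + (15 - 30 * Fintype.card F + 30) * tt F 1 1 + 30 * tt F 1 2) ∧
    ∃ a b c d e f : ℤ, 
    RR F 7 = 5040 * tt F 7 0 + 120 * ((21 * Fintype.card F - 70) * tt F 5 0 - 21 * tt F 5 1)
      + 6 * (210 * tt F 3 2 + a * tt F 3 1 + b * tt F 3 0)
      + (c * tt F 1 0 + d * tt F 1 1 + e * tt F 1 2 + f * tt F 1 3) := by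
  have H : ∀ D : Polynomial F, _ := fun D => eD_all D _ rfl
  simp only [EE] at H
  push_cast at H
  refine ⟨?_, ?_, ?_, ?_⟩
  · simp only [RR, tt]
    refine sum_congr rfl fun D _ => ?_
    have h := H D
    rw [h.1]; simp
  · simp only [RR, tt, mul_sum, ← sum_add_distrib, ← sum_sub_distrib]
    refine sum_congr rfl fun D _ => ?_
    obtain ⟨h1, h3, h5, h7⟩ := H D
    simp only [Nat.choose_zero_right, Nat.choose_one_right, Nat.cast_one, one_mul]
    rw [h3, h1]
    ring
  · simp only [RR, tt, mul_sum, ← sum_add_distrib, ← sum_sub_distrib]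
    refine sum_congr rfl fun D _ => ?_
    obtain ⟨h1, h3, h5, h7⟩ := H D
    have c2 := ch2 (zer D).card
    simp only [Nat.choose_zero_right, Nat.choose_one_right, Nat.cast_one, one_mul]
    rw [h1, h5]
    linear_combination (-10 * (Fintype.card F - (zer D).card : ℤ) + 20) * h3 + 15 * SS D * c2
  · refine ⟨105 - 210 * Fintype.card F + 490, 105 * (Fintype.card F : ℤ) ^ 2 - 490 * Fintype.card F + 616,
      105 * (Fintype.card F : ℤ) ^ 3 - 420 * (Fintype.card F : ℤ) ^ 2 + 588 * Fintype.card F - 272,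
      -315 * (Fintype.card F : ℤ) ^ 2 + 840 * Fintype.card F - 588 + (315 * Fintype.card F - 420) - 105,
      2 * (315 * Fintype.card F - 420) - 630, -630, ?_⟩
    simp only [RR, tt, mul_sum, ← sum_add_distrib, ← sum_sub_distrib]
    refine sum_congr rfl fun D _ => ?_
    obtain ⟨h1, h3, h5, h7⟩ := H D
    have c2 := ch2 (zer D).card
    have c3 := ch3 (zer D).card
    simp only [Nat.choose_zero_right, Nat.choose_one_right, Nat.cast_one, one_mul]
    rw [h1, h7]
    generalize ((zer D).card : ℤ) = N at *
    generalize (Fintype.card F : ℤ) = q at *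
    linear_combination (-21 * (q - N) + 70) * h5 - (105 * (q - N) ^ 2 - 490 * (q-N) + 616) * h3 
      + (315 * q - 420) * SS D * c2 - 105 * SS D * c3 + 105 * 6 * eD 3 D * c2

end Odd


section OddVals
variable {F : Type*} [Field F] [Fintype F] [DecidableEq F]

lemma v70 (hF : ringChar F ≠ 2) (q : ℤ) (hq : q = Fintype.card F) :
    2 * (5040 * ∑ Q ∈ Mon F 2, eD 7 Q) = q * (2 * EE 7 (-1 + q) (q - 1) + (q - 1) * (EE 7 (-1) (q - 2) +
      EE 7 (-1) q)) := by
  have : ∀ Q : Polynomial F, 5040 * eD 7 Q = (fun S N => EE 7 S (q - N)) (SS Q) (zer Q).card := by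
    intro Q
    rw [hq]
    exact (eD_all Q _ rfl).2.2.2
  rw [mul_sum, sum_congr rfl (fun Q _ => this Q), sum_Mon_two hF (fun S N => EE 7 S (q - N)), mul_left_comm, ← hq]
  have h := sum_chi_phi hF (fun x => (fun S N => EE 7 S (q - N)) (-1 + q * (1 - x ^ 2)) (1 + x))
  simp only [← hq] at h
  rw [h]
  norm_num

lemma xc_vals (hF : ringChar F ≠ 2) (c r : F) (D : Polynomial F) (hD : ∀ x, D.eval x = (x - c) * (x - r)) :
    (c = r → SS D = Fintype.card F - 1 ∧ ((zer D).card : ℤ) = 1) ∧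
    (c ≠ r → SS D = - 1 ∧ ((zer D).card : ℤ) = 2) := by
  have h2 := two_ne hF
  obtain ⟨h1, h3⟩ := quad_vals hF (-(c + r)) (c * r) (((c - r) / 2) ^ 2) (by field_simp; ring) D (by
    intro x; rw [hD]; ring)
  constructor
  · rintro rfl
    rw [h1, h3]
    simp
    ring
  · intro h
    have : (c - r) / 2 ≠ 0 := div_ne_zero (sub_ne_zero.2 h) h2
    rw [h1, h3, quadraticChar_sq_one' this]
    norm_num

lemma v51 (hF : ringChar F ≠ 2) (q : ℤ) (hq : q = Fintype.card F) :
    120 * ∑ c : F, ∑ r : F, eD 5 ((X - C c) * (X - C r)) =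
      q * (EE 5 (q - 1) (q - 1) + (q - 1) * EE 5 (-1) (q - 2)) := by
  have : ∀ c r : F, 120 * eD 5 ((X - C c) * (X - C r)) =
      EE 5 (-1) (q - 2) + if c = r then EE 5 (q - 1) (q - 1) - EE 5 (-1) (q - 2) else 0 := by
    intro c r
    obtain ⟨h1, h2⟩ := xc_vals hF c r ((X - C c) * (X - C r)) (by simp)
    rw [(eD_all ((X - C c) * (X - C r)) _ rfl).2.2.1]
    split_ifs with h
    · rw [(h1 h).1, (h1 h).2, ← hq]; ring
    · rw [(h2 h).1, (h2 h).2, ← hq]; ring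
  simp_rw [mul_sum, this, sum_add_distrib, sum_ite_eq]
  simp [← hq]
  ring

lemma v32 (hF : ringChar F ≠ 2) (q : ℤ) (hq : q = Fintype.card F) :
    2 * (6 * ∑ c ∈ powersetCard 2 (univ : Finset F), eD 3 (nod c)) = q * (q - 1) * EE 3 (-1) (q - 2) := by
  have : ∀ c ∈ powersetCard 2 (univ : Finset F), 6 * eD 3 (nod c) = EE 3 (-1) (q - 2) := by
    intro c hc
    obtain ⟨a, b, hab, rfl⟩ := card_eq_two.1 (mem_powersetCard.1 hc).2
    obtain ⟨h1, h2⟩ := xc_vals hF a b (nod {a, b}) (by intro x; simp [nod, prod_pair hab])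
    rw [(eD_all (nod {a, b}) _ rfl).2.1, (h2 hab).1, (h2 hab).2, ← hq]
  rw [mul_sum, sum_congr rfl this, sum_const, card_powersetCard, nsmul_eq_mul, card_univ]
  have h := ch2 (Fintype.card F)
  rw [← hq] at h
  linear_combination (-EE 3 (-1) (q - 2)) * h

lemma RR_vals (hF : ringChar F ≠ 2) (ψ : AddChar F ℂ) (hψ : ψ.IsPrimitive) (q : ℤ) (hq : q = Fintype.card F) :
    RR F 1 = 0 ∧ RR F 3 = 0 ∧ RR F 5 = q^7-10*q^6+35*q^5-50*q^4+24*q^3 ∧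
    RR F 7 = q^9-7*q^8+21*q^7-105*q^6+434*q^5-728*q^4+384*q^3 := by
  obtain ⟨r1, r3, r5, a, b, c, d, e, f, r7⟩ := RR_formula (F := F)
  have z := tt_zero hF ψ hψ
  have t10 := z 1 0 (by norm_num) (by norm_num)
  have t11 := z 1 1 (by norm_num) (by norm_num)
  have t12 := z 1 2 (by norm_num) (by norm_num)
  have t13 := z 1 3 (by norm_num) (by norm_num)
  have t30 := z 3 0 (by norm_num) (by norm_num)
  have t31 := z 3 1 (by norm_num) (by norm_num)
  have t50 := tt50 hF ψ hψ
  have v7 := v70 hF q hq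
  have v5 := v51 hF q hq
  have v3 := v32 hF q hq
  rw [t10] at r1
  rw [t10, t11, t30, ← hq] at r3
  rw [t10, t11, t12, t30, t31, ← hq] at r5
  rw [← hq] at t50
  rw [t10, t11, t12, t30, t31, t13, tt70 hF ψ hψ, tt51 hF ψ hψ, tt32 hF ψ hψ, ← hq] at r7
  simp [EE] at t50 v7 v5 v3
  refine ⟨r1, by rw [r3]; ring, by rw [r5, t50]; ring, ?_⟩
  have : 2 * RR F 7 = 2 * (q^9-7*q^8+21*q^7-105*q^6+434*q^5-728*q^4+384*q^3) := by
    rw [r7]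
    linear_combination q * v7 + 2 * (21 * q - 70) * t50 - 42 * q * v5 + 210 * q * v3
  linarith

end OddVals


section Cubic
variable {F : Type*} [Field F] [Fintype F] [DecidableEq F]

/-- cubic character sum -/
noncomputable def S3 (a b c : F) : ℤ := ∑ x : F, quadraticChar F (x ^ 3 + a * x ^ 2 + b * x + c)

/-- quartic character sum -/
noncomputable def S4 (a b c d : F) : ℤ :=
  ∑ x : F, quadraticChar F (x ^ 4 + a * x ^ 3 + b * x ^ 2 + c * x + d)

/-- moments over all cubics -/
noncomputable def MM (F : Type*) [Field F] [Fintype F] [DecidableEq F] (n : ℕ) : ℤ :=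
  ∑ a : F, ∑ b : F, ∑ c : F, S3 a b c ^ n

lemma shift (g : F → ℤ) (t : F) : ∑ c : F, g (c + t) = ∑ c : F, g c :=
  Equiv.sum_comp (Equiv.addRight t) g

lemma scale (g : F → ℤ) (t : F) (ht : t ≠ 0) : ∑ c : F, g (t * c) = ∑ c : F, g c :=
  Equiv.sum_comp (Equiv.mulLeft₀ t ht) g

lemma S3_shift (a b c t : F) :
    S3 (a + 3 * t) (b + (3 * t ^ 2 + 2 * a * t)) (c + (t ^ 3 + a * t ^ 2 + b * t)) = S3 a b c := by
  rw [S3, S3, ← shift (fun x => quadraticChar F (x ^ 3 + a * x ^ 2 + b * x + c)) t]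
  refine sum_congr rfl fun x _ => ?_
  congr 1; ring

lemma stepPt (hF : ringChar F ≠ 2) (φ : ℤ → ℤ) :
    ∑ a : F, ∑ b : F, ∑ c : F, (Fintype.card F + S3 a b c) * φ (S3 a b c) =
      Fintype.card F * ∑ a : F, ∑ b : F, ∑ y : F, φ (S3 a b (y ^ 2)) := by
  have h1 : ∀ a b c : F, (Fintype.card F + S3 a b c) * φ (S3 a b c) =
      ∑ t : F, (fun a b c => (1 + quadraticChar F c) * φ (S3 a b c)) (a + 3 * t)
        (b + (3 * t ^ 2 + 2 * a * t)) (c + (t ^ 3 + a * t ^ 2 + b * t)) := by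
    intro a b c
    simp only [S3_shift]
    rw [← sum_mul, sum_add_distrib]
    congr 2
    · simp
    · rw [S3]
      refine sum_congr rfl fun x _ => ?_
      congr 1; ring
  simp only [h1]
  have h2 : ∀ G : F → F → F → ℤ, ∑ a : F, ∑ b : F, ∑ c : F, ∑ t : F, G (a + 3 * t)
            (b + (3 * t ^ 2 + 2 * a * t)) (c + (t ^ 3 + a * t ^ 2 + b * t)) =
        Fintype.card F * ∑ a : F, ∑ b : F, ∑ c : F, G a b c := by
    intro G
    calc _ = ∑ a : F, ∑ b : F, ∑ t : F, ∑ c : F, G (a + 3 * t)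
            (b + (3 * t ^ 2 + 2 * a * t)) (c + (t ^ 3 + a * t ^ 2 + b * t)) :=
          sum_congr rfl fun a _ => sum_congr rfl fun b _ => sum_comm
      _ = ∑ a : F, ∑ b : F, ∑ t : F, ∑ c : F, G (a + 3 * t)
            (b + (3 * t ^ 2 + 2 * a * t)) c :=
          sum_congr rfl fun a _ => sum_congr rfl fun b _ => sum_congr rfl fun t _ =>
            shift (fun c => G (a + 3 * t) (b + (3 * t ^ 2 + 2 * a * t)) c) _
      _ = ∑ a : F, ∑ t : F, ∑ b : F, ∑ c : F, G (a + 3 * t)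
            (b + (3 * t ^ 2 + 2 * a * t)) c := sum_congr rfl fun a _ => sum_comm
      _ = ∑ a : F, ∑ t : F, ∑ b : F, ∑ c : F, G (a + 3 * t) b c :=
          sum_congr rfl fun a _ => sum_congr rfl fun t _ => 
            shift (fun b => ∑ c : F, G (a + 3 * t) b c) _
      _ = ∑ t : F, ∑ a : F, ∑ b : F, ∑ c : F, G (a + 3 * t) b c := sum_comm
      _ = ∑ t : F, ∑ a : F, ∑ b : F, ∑ c : F, G a b c :=
          sum_congr rfl fun t _ => shift (fun a => ∑ b : F, ∑ c : F, G a b c) _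
      _ = _ := by simp
  refine (h2 (fun a b c => (1 + quadraticChar F c) * φ (S3 a b c))).trans ?_
  congr 1
  refine sum_congr rfl fun a _ => sum_congr rfl fun b _ => ?_
  exact (sum_sq hF (fun c => φ (S3 a b c))).symm

lemma S4_dep (h4 : (4 : F) ≠ 0) (a b c d : F) :
    S4 a b c d = S4 0 (b + (-(3/8) * a ^ 2)) (c + (a ^ 3 / 8 - a * b / 2))
      (d + (-3 * a ^ 4 / 256 + a ^ 2 * b / 16 - a * c / 4)) := by
  have h2 : (2 : F) ≠ 0 := by intro h; apply h4; linear_combination 2 * h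
  have h8 : (8 : F) ≠ 0 := by
    have := mul_ne_zero h4 h2
    norm_num at this; exact this
  have h16 : (16 : F) ≠ 0 := by
    have := mul_ne_zero h8 h2
    norm_num at this; exact this
  have h256 : (256 : F) ≠ 0 := by
    have := mul_ne_zero h16 h16
    norm_num at this; exact this
  rw [S4, S4, ← shift (fun x => quadraticChar F (x ^ 4 + a * x ^ 3 + b * x ^ 2 + c * x + d)) (-(a/4))]
  refine sum_congr rfl fun x _ => ?_
  congr 1
  field_simp
  ring

lemma four_ne (hF : ringChar F ≠ 2) : (4 : F) ≠ 0 := by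
  have := mul_ne_zero (two_ne hF) (two_ne hF)
  norm_num at this; exact this

lemma sum_S4 (hF : ringChar F ≠ 2) (φ : ℤ → ℤ) :
    ∑ a : F, ∑ b : F, ∑ c : F, ∑ d : F, φ (S4 a b c d) =
    Fintype.card F * ∑ a : F, ∑ b : F, ∑ y : F, φ (S4 0 (-2 * a) (8 * y) (-4 * b + a ^ 2)) := by
  have h4 := four_ne hF
  have h2 := two_ne hF
  have h8 : (8 : F) ≠ 0 := by
    have := mul_ne_zero h4 h2
    norm_num at this; exact this
  calc _ = ∑ a : F, ∑ b : F, ∑ c : F, ∑ d : F, φ (S4 0 (b + (-(3/8) * a ^ 2)) (c + (a ^ 3 / 8 - a * b / 2))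
      (d + (-3 * a ^ 4 / 256 + a ^ 2 * b / 16 - a * c / 4))) := 
        sum_congr rfl fun a _ => sum_congr rfl fun b _ => sum_congr rfl fun c _ =>
          sum_congr rfl fun d _ => by rw [← S4_dep h4]
    _ = ∑ a : F, ∑ b : F, ∑ c : F, ∑ d : F, φ (S4 0 (b + (-(3/8) * a ^ 2)) (c + (a ^ 3 / 8 - a * b / 2)) d) := 
        sum_congr rfl fun a _ => sum_congr rfl fun b _ => sum_congr rfl fun c _ =>
          shift (fun d => φ (S4 0 (b + (-(3/8) * a ^ 2)) (c + (a ^ 3 / 8 - a * b / 2)) d)) _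
    _ = ∑ a : F, ∑ b : F, ∑ c : F, ∑ d : F, φ (S4 0 (b + (-(3/8) * a ^ 2)) c d) := 
        sum_congr rfl fun a _ => sum_congr rfl fun b _ => 
          shift (fun c => ∑ d : F, φ (S4 0 (b + (-(3/8) * a ^ 2)) c d)) _
    _ = ∑ a : F, ∑ b : F, ∑ c : F, ∑ d : F, φ (S4 0 b c d) := 
        sum_congr rfl fun a _ => 
          shift (fun b => ∑ c : F, ∑ d : F, φ (S4 0 b c d)) _
    _ = Fintype.card F * ∑ b : F, ∑ c : F, ∑ d : F, φ (S4 0 b c d) := by simp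
    _ = Fintype.card F * ∑ b : F, ∑ d : F, ∑ c : F, φ (S4 0 b c d) := by
        congr 1; exact sum_congr rfl fun b _ => sum_comm
    _ = Fintype.card F * ∑ a : F, ∑ d : F, ∑ c : F, φ (S4 0 (-2 * a) c d) := by
        congr 1
        exact (scale (fun b => ∑ d : F, ∑ c : F, φ (S4 0 b c d)) (-2) (by simpa using h2)).symm
    _ = Fintype.card F * ∑ a : F, ∑ d : F, ∑ c : F, φ (S4 0 (-2 * a) c (d + a ^ 2)) := by
        congr 1; refine sum_congr rfl fun a _ => ?_
        exact (shift (fun d => ∑ c : F, φ (S4 0 (-2 * a) c d)) (a ^ 2)).symm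
    _ = Fintype.card F * ∑ a : F, ∑ b : F, ∑ c : F, φ (S4 0 (-2 * a) c (-4 * b + a ^ 2)) := by
        congr 1; refine sum_congr rfl fun a _ => ?_
        exact (scale (fun d => ∑ c : F, φ (S4 0 (-2 * a) c (d + a ^ 2))) (-4) (by simpa using h4)).symm
    _ = _ := by
        congr 1; refine sum_congr rfl fun a _ => sum_congr rfl fun b _ => ?_
        exact (scale (fun c => φ (S4 0 (-2 * a) c (-4 * b + a ^ 2))) 8 h8).symm

lemma RR_S4 (n : ℕ) : RR F n = ∑ a : F, ∑ b : F, ∑ c : F, ∑ d : F, S4 a b c d ^ n := by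
  rw [RR, sum_Mon_succ]
  simp_rw [sum_Mon_succ, sum_Mon_zero]
  have : ∀ a b c d : F, SS (X * (X * (X * (X * 1 + C a) + C b) + C c) + C d) = S4 a b c d := by
    intro a b c d
    rw [SS, S4]
    refine sum_congr rfl fun x _ => ?_
    congr 1; simp; ring
  simp_rw [this]
  calc _ = ∑ d : F, ∑ b : F, ∑ c : F, ∑ a : F, S4 a b c d ^ n := sum_congr rfl fun d _ => sum_comm
    _ = ∑ d : F, ∑ b : F, ∑ a : F, ∑ c : F, S4 a b c d ^ n := 
      sum_congr rfl fun d _ => sum_congr rfl fun b _ => sum_comm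
    _ = ∑ d : F, ∑ a : F, ∑ b : F, ∑ c : F, S4 a b c d ^ n := 
      sum_congr rfl fun d _ => sum_comm
    _ = ∑ a : F, ∑ d : F, ∑ b : F, ∑ c : F, S4 a b c d ^ n := sum_comm
    _ = ∑ a : F, ∑ b : F, ∑ d : F, ∑ c : F, S4 a b c d ^ n := sum_congr rfl fun a _ => sum_comm
    _ = _ := sum_congr rfl fun a _ => sum_congr rfl fun b _ => sum_comm

lemma MM_odd (hF : ringChar F ≠ 2) (n : ℕ) (hn : Odd n) : MM F n = 0 := by
  obtain ⟨g, hg⟩ := quadraticChar_exists_neg_one hF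
  have hg0 : g ≠ 0 := by rintro rfl; simp at hg
  have h : ∀ a b c : F, S3 (g * a) (g ^ 2 * b) (g ^ 3 * c) = - S3 a b c := by
    intro a b c
    rw [S3, S3, ← scale _ g hg0, ← sum_neg_distrib]
    refine sum_congr rfl fun x _ => ?_
    have : (g * x) ^ 3 + g * a * (g * x) ^ 2 + g ^ 2 * b * (g * x) + g ^ 3 * c =
      g ^ 3 * (x ^ 3 + a * x ^ 2 + b * x + c) := by ring
    rw [this, map_mul, map_pow, hg]; ring
  have : MM F n = - MM F n := by
    conv_lhs => rw [MM]
    calc _ = ∑ a : F, ∑ b : F, ∑ c : F, S3 (g * a) b c ^ n :=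
          (scale (fun a => ∑ b : F, ∑ c : F, S3 a b c ^ n) g hg0).symm
      _ = ∑ a : F, ∑ b : F, ∑ c : F, S3 (g * a) (g ^ 2 * b) c ^ n := sum_congr rfl fun a _ =>
          (scale (fun b => ∑ c : F, S3 (g * a) b c ^ n) (g ^ 2) (pow_ne_zero _ hg0)).symm
      _ = ∑ a : F, ∑ b : F, ∑ c : F, S3 (g * a) (g ^ 2 * b) (g ^ 3 * c) ^ n := 
          sum_congr rfl fun a _ => sum_congr rfl fun b _ =>
          (scale (fun c => S3 (g * a) (g ^ 2 * b) c ^ n) (g ^ 3) (pow_ne_zero _ hg0)).symm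
      _ = _ := by
        rw [MM]
        simp_rw [h, hn.neg_pow, sum_neg_distrib]
  linarith

end Cubic


section Fib
variable {F : Type*} [Field F] [Fintype F] [DecidableEq F]

lemma ind_sq (hF : ringChar F ≠ 2) (u : F) :
    ∑ Y : F, (if Y ^ 2 = u then (1:ℤ) else 0) = 1 + quadraticChar F u := by
  rw [← card_sq hF, ← sum_filter]; simp

lemma ind_quad (hF : ringChar F ≠ 2) (b c : F) :
    ∑ x : F, (if x ^ 2 + b * x + c = 0 then (1:ℤ) else 0) = 1 + quadraticChar F (b ^ 2 - 4 * c) := by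
  have h2 := two_ne hF
  have h := (quad_vals hF b c ((b / 2) ^ 2 - c) rfl (X ^ 2 + C b * X + C c) (by simp)).2
  have h3 : b ^ 2 - 4 * c = 2 ^ 2 * ((b / 2) ^ 2 - c) := by field_simp; ring
  rw [h3, map_mul, map_pow, quadraticChar_sq_one h2, one_mul, ← h, zer, ← sum_filter]
  simp

lemma rel (hF : ringChar F ≠ 2) (a b y : F) :
    S3 a b (y ^ 2) = S4 0 (-2 * a) (8 * y) (-4 * b + a ^ 2) + 1 -
      if b = 0 ∧ y = 0 then (Fintype.card F : ℤ) else 0 := by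
  have h2 := two_ne hF
  -- points
  have e1 : (Fintype.card F : ℤ) + S3 a b (y ^ 2) =
      ∑ x : F, ∑ Y : F, if Y ^ 2 = x ^ 3 + a * x ^ 2 + b * x + y ^ 2 then (1 : ℤ) else 0 := by
    simp_rw [ind_sq hF]
    rw [sum_add_distrib, S3]; simp
  have e2 : ∀ x ∈ (univ : Finset F).erase 0, (∑ Y : F, if Y ^ 2 = x ^ 3 + a * x ^ 2 + b * x + y ^ 2 then (1 : ℤ) else 0)
      = ∑ s : F, if x ^ 2 + (a - s ^ 2) * x + (b - 2 * s * y) = 0 then (1 : ℤ) else 0 := by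
    intro x hx
    have hx0 : x ≠ 0 := (mem_erase.1 hx).1
    rw [← shift _ y, ← scale _ x hx0]
    refine sum_congr rfl fun s _ => ?_
    refine if_congr ?_ rfl rfl
    constructor
    · intro h
      have : x * (x ^ 2 + (a - s ^ 2) * x + (b - 2 * s * y)) = 0 := by linear_combination -h
      exact (mul_eq_zero.1 this).resolve_left hx0
    · intro h
      linear_combination (-x) * h
  have e3 : S4 0 (-2 * a) (8 * y) (-4 * b + a ^ 2) + Fintype.card F =
      ∑ x : F, ∑ s : F, if x ^ 2 + (a - s ^ 2) * x + (b - 2 * s * y) = 0 then (1 : ℤ) else 0 := by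
    rw [sum_comm]
    simp_rw [ind_quad hF]
    rw [sum_add_distrib, S4, add_comm]
    congr 1
    · simp
    · refine sum_congr rfl fun s _ => ?_
      congr 1; ring
  rw [← add_sum_erase _ _ (mem_univ 0)] at e1 e3
  rw [sum_congr rfl e2] at e1
  have e4 : (∑ Y : F, if Y ^ 2 = (0:F) ^ 3 + a * 0 ^ 2 + b * 0 + y ^ 2 then (1 : ℤ) else 0) =
      if y = 0 then 1 else 2 := by
    rw [ind_sq hF]
    split_ifs with h
    · subst h; simp
    · have : (0:F) ^ 3 + a * 0 ^ 2 + b * 0 + y ^ 2 = y ^ 2 := by ring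
      rw [this, quadraticChar_sq_one' h]; norm_num
  have e5 : (∑ s : F, if (0:F) ^ 2 + (a - s ^ 2) * 0 + (b - 2 * s * y) = 0 then (1 : ℤ) else 0) =
      if y = 0 then (if b = 0 then (Fintype.card F : ℤ) else 0) else 1 := by
    split_ifs with h hb
    · subst h; subst hb; simp
    · subst h; simp [hb]
    · rw [sum_eq_single (b / (2 * y))]
      · rw [if_pos]; field_simp; ring
      · intro s _ hs
        rw [if_neg]
        intro h'
        apply hs
        field_simp
        linear_combination -h'
      · simp
  rw [e4] at e1
  rw [e5] at e3
  by_cases hy : y = 0 <;> by_cases hb : b = 0 <;> simp [hy, hb] at e1 e3 ⊢ <;> linarith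

lemma S3_deg (hF : ringChar F ≠ 2) (a : F) : S3 a 0 0 = - quadraticChar F a := by
  have h : ∀ x : F, quadraticChar F (x ^ 3 + a * x ^ 2 + 0 * x + 0) = quadraticChar F (x + a) -
      if x = 0 then quadraticChar F a else 0 := by
    intro x
    split_ifs with h
    · subst h; simp
    · have : x ^ 3 + a * x ^ 2 + 0 * x + 0 = x ^ 2 * (x + a) := by ring
      rw [this, map_mul, map_pow, quadraticChar_sq_one h]; ring
  rw [S3, sum_congr rfl (fun x _ => h x), sum_sub_distrib, shift (fun x => quadraticChar F x), chi_sum hF]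
  simp

lemma main_rel (hF : ringChar F ≠ 2) (n : ℕ) :
    2 * (Fintype.card F * MM F n + MM F (n + 1)) = 2 * ∑ j ∈ range (n + 1), RR F j * (n.choose j : ℕ) +
      Fintype.card F * (2 * (0 ^ n - (Fintype.card F : ℤ) ^ n) + (Fintype.card F - 1) *
        (((-1) ^ n - ((Fintype.card F : ℤ) - 1) ^ n) + (1 - ((Fintype.card F : ℤ) + 1) ^ n))) := by
  have h1 : (Fintype.card F * MM F n + MM F (n + 1)) = 
      Fintype.card F * ∑ a : F, ∑ b : F, ∑ y : F, S3 a b (y ^ 2) ^ n := by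
    rw [← stepPt hF (fun S => S ^ n)]
    simp only [MM, mul_sum, ← sum_add_distrib]
    refine sum_congr rfl fun a _ => sum_congr rfl fun b _ => sum_congr rfl fun c _ => ?_
    ring
  have h2 : ∀ a b y : F, S3 a b (y ^ 2) ^ n = (S4 0 (-2 * a) (8 * y) (-4 * b + a ^ 2) + 1) ^ n +
      if b = 0 then (if y = 0 then (fun x : ℤ => (-x) ^ n - (Fintype.card F - x) ^ n) (quadraticChar F a) else 0) else 0 := by
    intro a b y
    have hr := rel hF a b y
    by_cases hb : b = 0
    · by_cases hy : y = 0
      · have h3 := S3_deg hF a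
        subst hb; subst hy
        simp only [and_self, if_true] at hr ⊢
        have h0 : (0:F) ^ 2 = 0 := by ring
        rw [h0] at hr ⊢
        rw [h3] at hr ⊢
        have : S4 0 (-2 * a) (8 * 0) (-4 * 0 + a ^ 2) + 1 = Fintype.card F - quadraticChar F a := by
          linarith
        rw [this]; ring
      · rw [hr]; simp [hb, hy]
    · rw [hr]; simp [hb]
  have h3 : Fintype.card F * ∑ a : F, ∑ b : F, ∑ y : F, (S4 0 (-2 * a) (8 * y) (-4 * b + a ^ 2) + 1) ^ n =
      ∑ j ∈ range (n + 1), RR F j * (n.choose j : ℕ) := by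
    rw [← sum_S4 hF (fun S => (S + 1) ^ n)]
    simp only [RR_S4, sum_mul]
    simp_rw [add_pow, one_pow, mul_one]
    calc _ = ∑ a : F, ∑ b : F, ∑ c : F, ∑ j ∈ range (n + 1), ∑ d : F, S4 a b c d ^ j * (n.choose j : ℤ) :=
          sum_congr rfl fun a _ => sum_congr rfl fun b _ => sum_congr rfl fun c _ => sum_comm
      _ = ∑ a : F, ∑ b : F, ∑ j ∈ range (n + 1), ∑ c : F, ∑ d : F, S4 a b c d ^ j * (n.choose j : ℤ) :=
          sum_congr rfl fun a _ => sum_congr rfl fun b _ => sum_comm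
      _ = ∑ a : F, ∑ j ∈ range (n + 1), ∑ b : F, ∑ c : F, ∑ d : F, S4 a b c d ^ j * (n.choose j : ℤ) :=
          sum_congr rfl fun a _ => sum_comm
      _ = _ := sum_comm
  have h4 := sum_chi_phi hF (fun x : ℤ => (-x) ^ n - (Fintype.card F - x) ^ n)
  rw [h1]
  simp only [h2, sum_add_distrib]
  rw [mul_add, h3]
  have h5 : ∑ a : F, ∑ b : F, ∑ y : F, (if b = 0 then (if y = 0 then ((-quadraticChar F a) ^ n - (Fintype.card F - quadraticChar F a) ^ n) else 0) else 0 : ℤ)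
      = ∑ a : F, (fun x : ℤ => (-x) ^ n - (Fintype.card F - x) ^ n) (quadraticChar F a) := by
    refine sum_congr rfl fun a _ => ?_
    rw [sum_eq_single 0 (by intro b _ hb; simp [hb]) (by simp)]
    simp
  rw [h5]
  simp only [neg_zero, sub_zero, neg_neg, sub_neg_eq_add, one_pow] at h4
  linear_combination (Fintype.card F : ℤ) * h4

lemma MM_vals (hF : ringChar F ≠ 2) (ψ : AddChar F ℂ) (hψ : ψ.IsPrimitive) (q : ℤ) (hq : q = Fintype.card F) :
    MM F 0 = q^3 ∧ MM F 2 = q^4-q^3 ∧ MM F 4 = 2*q^5-2*q^4-3*q^3+3*q^2 ∧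
    MM F 6 = 5*q^6-5*q^5-9*q^4+4*q^3+5*q^2 ∧ MM F 8 = 14*q^7-14*q^6-28*q^5+8*q^4+13*q^3+7*q^2 := by
  obtain ⟨r1, r3, r5, r7⟩ := RR_vals hF ψ hψ q hq
  have r0 : RR F 0 = q ^ 4 := by simp [RR, card_Mon, hq]
  have m0 : MM F 0 = q ^ 3 := by simp [MM, hq]; ring
  have m1 := MM_odd hF 1 (by decide)
  have m3 := MM_odd hF 3 (by decide)
  have m5 := MM_odd hF 5 (by decide)
  have m7 := MM_odd hF 7 (by decide)
  have n1 := main_rel hF 1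
  have n2 := main_rel hF 2
  have n3 := main_rel hF 3
  have n4 := main_rel hF 4
  have n5 := main_rel hF 5
  have n6 := main_rel hF 6
  have n7 := main_rel hF 7
  simp only [← hq, sum_range_succ, range_zero, sum_empty, Nat.reduceAdd, m1, m3, m5, m7, r0, r1, r3, r5, r7] at n1 n2 n3 n4 n5 n6 n7
  norm_num [Nat.choose] at n1 n2 n3 n4 n5 n6 n7
  have t : (2:ℤ) ≠ 0 := two_ne_zero
  have m2 : MM F 2 = q^4-q^3 := mul_left_cancel₀ t (by linear_combination n1)
  have r2 : RR F 2 = q^5-q^4 := mul_left_cancel₀ t (by linear_combination -n2 + 2 * q * m2)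
  have m4 : MM F 4 = 2*q^5-2*q^4-3*q^3+3*q^2 := mul_left_cancel₀ t (by linear_combination n3 + 6 * r2)
  have r4 : RR F 4 = 3*q^6-8*q^5+8*q^4-3*q^3 := mul_left_cancel₀ t (by
    linear_combination -n4 + 2 * q * m4 - 12 * r2)
  have m6 : MM F 6 = 5*q^6-5*q^5-9*q^4+4*q^3+5*q^2 := mul_left_cancel₀ t (by
    linear_combination n5 + 20 * r2 + 10 * r4)
  have r6 : RR F 6 = q^8-q^7+25*q^6-129*q^5+213*q^4-109*q^3 := mul_left_cancel₀ t (by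
    linear_combination -n6 + 2 * q * m6 - 30 * r2 - 30 * r4)
  have m8 : MM F 8 = 14*q^7-14*q^6-28*q^5+8*q^4+13*q^3+7*q^2 := mul_left_cancel₀ t (by
    linear_combination n7 + 42 * r2 + 70 * r4 + 14 * r6)
  exact ⟨m0, m2, m4, m6, m8⟩

end Fib


section Sqf
variable {F : Type*} [Field F] [Fintype F] [DecidableEq F]

/-- the monic cubic with given coefficients -/
noncomputable def cub (c : F × F × F) : Polynomial F := X ^ 3 + C c.1 * X ^ 2 + C c.2.1 * X + C c.2.2

lemma cub_eq (c : F × F × F) : cub c = C 1 * X ^ 3 + C c.1 * X ^ 2 + C c.2.1 * X + C c.2.2 := by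
  simp [cub]

lemma cub_deg (c : F × F × F) : (cub c).natDegree = 3 := by
  rw [cub_eq]; exact natDegree_cubic one_ne_zero

lemma cub_monic (c : F × F × F) : (cub c).Monic := by
  rw [Monic, cub_eq]; exact leadingCoeff_cubic one_ne_zero

lemma cub_inj : Function.Injective (cub : F × F × F → Polynomial F) := by
  rintro ⟨a, b, c⟩ ⟨a', b', c'⟩ h
  have h0 := congrArg (fun P => P.coeff 0) h
  have h1 := congrArg (fun P => P.coeff 1) h
  have h2 := congrArg (fun P => P.coeff 2) h
  simp [cub, coeff_X, coeff_C] at h0 h1 h2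
  rw [h0, h1, h2]

/-- the coefficients of `(X-r)^2 (X-s)` -/
def rs (z : F × F) : F × F × F := (-(2 * z.1 + z.2), z.1 ^ 2 + 2 * z.1 * z.2, -(z.1 ^ 2 * z.2))

lemma cub_rs (z : F × F) : cub (rs z) = (X - C z.1) ^ 2 * (X - C z.2) := by
  simp only [cub, rs, map_neg, map_add, map_mul, map_pow, map_ofNat]
  ring

lemma rs_inj : Function.Injective (rs : F × F → F × F × F) := by
  rintro ⟨r, s⟩ ⟨r', s'⟩ h
  simp only [rs, Prod.mk.injEq] at h
  obtain ⟨h1, h2, h3⟩ := h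
  have e1 : (r - r') ^ 2 * (r - s') = 0 := by linear_combination -r ^ 2 * h1 - r * h2 - h3
  have e2 : (r' - r) ^ 2 * (r' - s) = 0 := by linear_combination r' ^ 2 * h1 + r' * h2 + h3
  have hr : r = r' := by
    by_contra hne
    have f1 := (mul_eq_zero.1 e1).resolve_left (pow_ne_zero _ (sub_ne_zero.2 hne))
    have f2 := (mul_eq_zero.1 e2).resolve_left (pow_ne_zero _ (sub_ne_zero.2 (Ne.symm hne)))
    apply hne
    linear_combination -h1 - f1 + f2
  subst hr
  have : s = s' := by linear_combination -h1
  rw [this]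

lemma nsq_iff (c : F × F × F) : ¬ Squarefree (cub c) ↔ ∃ z, rs z = c := by
  constructor
  · intro h
    rw [Squarefree] at h
    push Not at h
    obtain ⟨f, hf, hu⟩ := h
    have hne := (cub_monic c).ne_zero
    have hf0 : f ≠ 0 := by rintro rfl; simp at hf; exact hne hf
    have hd := natDegree_le_of_dvd hf hne
    rw [cub_deg, natDegree_mul hf0 hf0] at hd
    have hd0 : f.natDegree ≠ 0 := by
      intro h0
      exact hu ((isUnit_iff_degree_eq_zero).2 (by rw [degree_eq_natDegree hf0, h0]; rfl))
    have hd1 : f.degree = 1 := by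
      rw [degree_eq_natDegree hf0]; exact_mod_cast (by omega : f.natDegree = 1)
    obtain ⟨r, hr⟩ := exists_root_of_degree_eq_one hd1
    have hdv := dvd_iff_isRoot.2 hr
    obtain ⟨E, hE⟩ := (mul_dvd_mul hdv hdv).trans hf
    have hm : ((X - C r) * (X - C r)).Monic := (monic_X_sub_C r).mul (monic_X_sub_C r)
    have hEm : E.Monic := hm.of_mul_monic_left (hE ▸ cub_monic c)
    have hEd : E.natDegree = 1 := by
      have := cub_deg c
      rw [hE, hm.natDegree_mul hEm, (monic_X_sub_C r).natDegree_mul (monic_X_sub_C r)] at this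
      simp at this; omega
    have hEe := hEm.as_sum
    rw [hEd] at hEe
    simp at hEe
    refine ⟨(r, -E.coeff 0), cub_inj ?_⟩
    rw [cub_rs, hE]
    conv_rhs => rw [hEe]
    simp only [map_neg, sub_neg_eq_add]
    ring
  · rintro ⟨z, rfl⟩ h
    rw [cub_rs] at h
    have := h (X - C z.1) ⟨X - C z.2, by ring⟩
    exact not_isUnit_X_sub_C _ this

lemma S3_rs (hF : ringChar F ≠ 2) (z : F × F) : S3 (rs z).1 (rs z).2.1 (rs z).2.2 = - quadraticChar F (z.1 - z.2) := by
  obtain ⟨r, s⟩ := z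
  rw [← S3_deg hF]
  rw [← S3_shift _ _ _ r]
  congr 1 <;> simp only [rs] <;> ring

lemma nsq_sum (hF : ringChar F ≠ 2) (φ : ℤ → ℤ) (q : ℤ) (hq : q = Fintype.card F) :
    2 * ∑ c : F × F × F, (if Squarefree (cub c) then φ (S3 c.1 c.2.1 c.2.2) else 0) =
      2 * (∑ c : F × F × F, φ (S3 c.1 c.2.1 c.2.2)) - q * (2 * φ 0 + (q - 1) * (φ 1 + φ (-1))) := by
  have h1 : ∀ c : F × F × F, (if Squarefree (cub c) then φ (S3 c.1 c.2.1 c.2.2) else 0) =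
      φ (S3 c.1 c.2.1 c.2.2) - if ∃ z, rs z = c then φ (S3 c.1 c.2.1 c.2.2) else 0 := by
    intro c
    by_cases h : Squarefree (cub c)
    · have := (not_congr (nsq_iff c)).1 (not_not.2 h)
      rw [if_pos h, if_neg this]; ring
    · have := (nsq_iff c).1 h
      rw [if_neg h, if_pos this]; ring
  have h2 : (∑ c : F × F × F, if ∃ z, rs z = c then φ (S3 c.1 c.2.1 c.2.2) else 0) =
      ∑ z : F × F, φ (- quadraticChar F (z.1 - z.2)) := by
    rw [← sum_filter]
    symm
    refine sum_bij (fun z _ => rs z) ?_ ?_ ?_ ?_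
    · intro z _; simp
    · intro a _ b _ h; exact rs_inj h
    · intro c hc
      obtain ⟨z, hz⟩ := (mem_filter.1 hc).2
      exact ⟨z, mem_univ _, hz⟩
    · intro z _
      rw [S3_rs hF]
  have h3 := sum_chi_phi hF (fun x => φ (-x))
  simp only [h1, sum_sub_distrib, h2, Fintype.sum_prod_type_right]
  have h4 : ∀ s : F, ∑ r : F, φ (- quadraticChar F (r - s)) = ∑ x : F, φ (- quadraticChar F x) := by
    intro s
    exact Equiv.sum_comp (Equiv.subRight s) (fun x => φ (- quadraticChar F x))
  simp only [h4, sum_const, card_univ, nsmul_eq_mul, ← hq] at h3 ⊢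
  simp only [neg_zero, neg_neg] at h3
  linear_combination (-q) * h3

/-- squarefree moments -/
noncomputable def msf (F : Type*) [Field F] [Fintype F] [DecidableEq F] (n : ℕ) : ℤ :=
  ∑ c : F × F × F, (if Squarefree (cub c) then S3 c.1 c.2.1 c.2.2 ^ n else 0)

lemma MM_prod (n : ℕ) : ∑ c : F × F × F, S3 c.1 c.2.1 c.2.2 ^ n = MM F n := by
  simp only [Fintype.sum_prod_type, MM]

lemma msf_odd (hF : ringChar F ≠ 2) (n : ℕ) (hn : Odd n) : msf F n = 0 := by
  have h := nsq_sum hF (fun S => S ^ n) _ rfl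
  simp only [MM_prod, MM_odd hF n hn, hn.neg_pow, one_pow, zero_pow hn.pos.ne'] at h
  rw [msf]; linarith

lemma msf_even (hF : ringChar F ≠ 2) (n : ℕ) (hn : Even n) (h0 : n ≠ 0) (q : ℤ) (hq : q = Fintype.card F) :
    msf F n = MM F n - q * (q - 1) := by
  have h := nsq_sum hF (fun S => S ^ n) q hq
  simp only [MM_prod, hn.neg_pow, one_pow, zero_pow h0] at h
  rw [msf]; linarith

lemma msf_zero (hF : ringChar F ≠ 2) (q : ℤ) (hq : q = Fintype.card F) :
    msf F 0 = q ^ 3 - q ^ 2 := by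
  have h := nsq_sum hF (fun S => S ^ 0) q hq
  have m0 : MM F 0 = q ^ 3 := by simp [MM, hq]; ring
  simp only [MM_prod, m0] at h
  rw [msf]; linarith

lemma aQ_cub (c : F × F × F) : aQ (cub c) = - S3 c.1 c.2.1 c.2.2 := by
  rw [aQ, S3]
  congr 1
  refine sum_congr rfl fun x _ => ?_
  have : (cub c).eval x = x ^ 3 + c.1 * x ^ 2 + c.2.1 * x + c.2.2 := by simp [cub]
  rw [this, quadChar, quadraticChar_apply, quadraticCharFun]
  split_ifs <;> rfl

lemma expand (u : ℝ) (k : ℕ) :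
    ∑ c : F × F × F, (if Squarefree (cub c) then (2 - (aQ (cub c) : ℝ) * u) ^ k else 0) =
      ∑ j ∈ range (k + 1), (msf F j : ℝ) * (u ^ j * 2 ^ (k - j) * (k.choose j : ℝ)) := by
  simp only [msf, Int.cast_sum, sum_mul]
  rw [sum_comm]
  refine sum_congr rfl fun c _ => ?_
  split_ifs with h
  · rw [aQ_cub]
    have : (2 - ((-S3 c.1 c.2.1 c.2.2 : ℤ) : ℝ) * u) = (S3 c.1 c.2.1 c.2.2 : ℝ) * u + 2 := by
      push_cast; ring
    rw [this, add_pow]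
    refine sum_congr rfl fun j _ => ?_
    rw [mul_pow]; push_cast; ring
  · simp

end Sqf

/-- The `d = 3` moment formula: for `p > 3` prime and `1 ≤ k ≤ 9`,
`(1/(p³−p²)) Σ_{D ∈ H_{p,3}} L(1/2,χ_D)^k
  = (2/(k+2))·C(2k+1,k) − 2 Σ_{l=1}^{⌊k/2⌋} C(2k+1,k−2l) (2l+1)/((k+2l+2) p^{l+1})`,
where `L(1/2,χ_D) = 2 − a_p(D)/√p` and monic squarefree cubics are parametrized by
their three non-leading coefficients. -/
theorem stmt_1 (p : ℕ) [Fact p.Prime] (hp : 3 < p) (k : ℕ) (hk1 : 1 ≤ k) (hk9 : k ≤ 9) :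
    (1 / ((p : ℝ) ^ 3 - (p : ℝ) ^ 2)) *
      ∑ c : ZMod p × ZMod p × ZMod p,
        (if Squarefree
            (X ^ 3 + C c.1 * X ^ 2 + C c.2.1 * X + C c.2.2 : Polynomial (ZMod p)) then
          (2 - (aQ (X ^ 3 + C c.1 * X ^ 2 + C c.2.1 * X + C c.2.2 :
              Polynomial (ZMod p)) : ℝ) / Real.sqrt p) ^ k
        else 0)
    = 2 / ((k : ℝ) + 2) * (Nat.choose (2 * k + 1) k : ℝ)
      - 2 * ∑ l ∈ Finset.Icc 1 (k / 2),
          (Nat.choose (2 * k + 1) (k - 2 * l) : ℝ) * (2 * (l : ℝ) + 1) /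
            (((k : ℝ) + 2 * (l : ℝ) + 2) * (p : ℝ) ^ (l + 1)) := by
  haveI : NeZero p := ⟨by omega⟩
  have hF : ringChar (ZMod p) ≠ 2 := by rw [ZMod.ringChar_zmod_n]; omega
  obtain ⟨m0, m2, m4, m6, m8⟩ := MM_vals (F := ZMod p) hF ZMod.stdAddChar
    (ZMod.isPrimitive_stdAddChar p) p (by rw [ZMod.card])
  have hc : (p : ℤ) = Fintype.card (ZMod p) := by rw [ZMod.card]
  have s0 := msf_zero (F := ZMod p) hF p hc
  have s2 := msf_even (F := ZMod p) hF 2 (by decide) (by norm_num) p hc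
  have s4 := msf_even (F := ZMod p) hF 4 (by decide) (by norm_num) p hc
  have s6 := msf_even (F := ZMod p) hF 6 (by decide) (by norm_num) p hc
  have s8 := msf_even (F := ZMod p) hF 8 (by decide) (by norm_num) p hc
  have s1 := msf_odd (F := ZMod p) hF 1 (by decide)
  have s3 := msf_odd (F := ZMod p) hF 3 (by decide)
  have s5 := msf_odd (F := ZMod p) hF 5 (by decide)
  have s7 := msf_odd (F := ZMod p) hF 7 (by decide)
  have s9 := msf_odd (F := ZMod p) hF 9 (by decide)
  rw [m2] at s2
  rw [m4] at s4
  rw [m6] at s6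
  rw [m8] at s8
  have hp0 : (p : ℝ) ≠ 0 := by positivity
  have hp1 : (p : ℝ) - 1 ≠ 0 := by
    have : (3 : ℝ) < p := by exact_mod_cast hp
    linarith
  have hp2 : (p : ℝ) ^ 3 - (p : ℝ) ^ 2 ≠ 0 := by
    have : (p : ℝ) ^ 3 - (p : ℝ) ^ 2 = (p : ℝ) ^ 2 * (p - 1) := by ring
    rw [this]; positivity
  have hu : (1 / Real.sqrt p) ^ 2 = 1 / (p : ℝ) := by
    rw [div_pow, Real.sq_sqrt (by positivity), one_pow]
  have u4 : (1 / Real.sqrt p) ^ 4 = (1 / (p : ℝ)) ^ 2 := by rw [← hu]; ring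
  have u6 : (1 / Real.sqrt p) ^ 6 = (1 / (p : ℝ)) ^ 3 := by rw [← hu]; ring
  have u8 : (1 / Real.sqrt p) ^ 8 = (1 / (p : ℝ)) ^ 4 := by rw [← hu]; ring
  have hE := expand (F := ZMod p) (1 / Real.sqrt p) k
  have hE' : (∑ c : ZMod p × ZMod p × ZMod p,
        (if Squarefree
            (X ^ 3 + C c.1 * X ^ 2 + C c.2.1 * X + C c.2.2 : Polynomial (ZMod p)) then
          (2 - (aQ (X ^ 3 + C c.1 * X ^ 2 + C c.2.1 * X + C c.2.2 :
              Polynomial (ZMod p)) : ℝ) / Real.sqrt p) ^ k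
        else 0)) = ∑ j ∈ range (k + 1), (msf (ZMod p) j : ℝ) *
          ((1 / Real.sqrt p) ^ j * 2 ^ (k - j) * (k.choose j : ℝ)) := by
    rw [← hE]
    refine sum_congr rfl fun c _ => ?_
    rw [div_eq_mul_one_div]
    rfl
  rw [hE']
  clear hE hE'
  generalize 1 / Real.sqrt p = u at *
  have e0 : (msf (ZMod p) 0 : ℝ) = p ^ 3 - p ^ 2 := by rw [s0]; push_cast; ring
  have e2 : (msf (ZMod p) 2 : ℝ) = (p ^ 3 - p ^ 2) * (p - 1 / p) := by
    rw [s2]; push_cast; field_simp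
  have e4 := congrArg (Int.cast : ℤ → ℝ) s4
  have e6 := congrArg (Int.cast : ℤ → ℝ) s6
  have e8 := congrArg (Int.cast : ℤ → ℝ) s8
  push_cast at e4 e6 e8
  have e1 : (msf (ZMod p) 1 : ℝ) = 0 := by rw [s1]; simp
  have e3 : (msf (ZMod p) 3 : ℝ) = 0 := by rw [s3]; simp
  have e5 : (msf (ZMod p) 5 : ℝ) = 0 := by rw [s5]; simp
  have e7 : (msf (ZMod p) 7 : ℝ) = 0 := by rw [s7]; simp
  have e9 : (msf (ZMod p) 9 : ℝ) = 0 := by rw [s9]; simp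
  generalize (p : ℝ) = x at *
  interval_cases k <;>
    norm_num [sum_range_succ, sum_Icc_succ_top, Nat.choose, e0, e1, e2, e3, e4, e5, e6, e7, e8, e9, hu, u4, u6, u8] <;>
    field_simp <;> ring
end
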